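/- Let d ≥ 1, β₀ ≥ 0 and h₀ ∈ ℝ, and suppose that some Gibbs measure for the nearest-neighbour Ising model on ℤ^d at (β₀,h₀) is weak mixing. Then for every finite set A ⊂ ℤ^d there exist an open set U ⊆ ℝ² containing (β₀,h₀) and a real-analytic function F : U → ℝ such that for every (β,h) ∈ U, the torus correlation ⟨σ_A⟩_{N,β,h} := μ_{N,β,h}(∏_{i∈A} σ_i) converges to F(β,h) as N → ∞ (A being identified with a subset of the torus 𝕋^d_N for all N large enough). -/

import Mathlib

open MeasureTheory Filter

namespace IsingP

abbrev Site (d : ℕ) := Fin d → ℤ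
abbrev Config (d : ℕ) := Site d → Bool

noncomputable def spin (b : Bool) : ℝ := if b then 1 else -1

def nbrs {d : ℕ} (i : Site d) : Finset (Site d) :=
  Finset.univ.image
    (fun q : Fin d × Bool => fun k => if k = q.1 then i k + (if q.2 then 1 else -1) else i k)

noncomputable def hamElem {d : ℕ} (β h : ℝ) (Λ : Finset (Site d)) (η ω : Config d) : ℝ :=
  β * (2⁻¹ * ∑ i ∈ Λ, ∑ j ∈ nbrs i ∩ Λ, spin (η i) * spin (η j))
    + β * ∑ i ∈ Λ, ∑ j ∈ nbrs i \ Λ, spin (η i) * spin (ω j)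
    + h * ∑ i ∈ Λ, spin (η i)

def patch {d : ℕ} (Λ : Finset (Site d)) (η : {x // x ∈ Λ} → Bool) (ω : Config d) : Config d :=
  fun i => if hi : i ∈ Λ then η ⟨i, hi⟩ else ω i

noncomputable def localDensity {d : ℕ} (β h : ℝ) (Λ : Finset (Site d))
    (f : Config d → ℝ) (ω : Config d) : ℝ :=
  (∑ η : {x // x ∈ Λ} → Bool, f (patch Λ η ω) * Real.exp (hamElem β h Λ (patch Λ η ω) ω)) /
    (∑ η : {x // x ∈ Λ} → Bool, Real.exp (hamElem β h Λ (patch Λ η ω) ω))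

def IsGibbs (d : ℕ) (β h : ℝ) (μ : Measure (Config d)) : Prop :=
  IsProbabilityMeasure μ ∧
    ∀ (Λ : Finset (Site d)) (f : Config d → ℝ), Measurable f → (∃ M, ∀ σ, |f σ| ≤ M) →
      ∫ σ, f σ ∂μ = ∫ ω, localDensity β h Λ f ω ∂μ

def cylEvents {d : ℕ} (Δ : Set (Site d)) : MeasurableSpace (Config d) :=
  MeasurableSpace.comap (fun σ (i : Δ) => σ i.val) inferInstance

noncomputable def dist1 {d : ℕ} (a b : Site d) : ℝ := ((∑ k, |a k - b k| : ℤ) : ℝ)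

def WeakMixing (d : ℕ) (μ : Measure (Config d)) : Prop :=
  ∃ C : ℝ, 0 ≤ C ∧ ∃ c : ℝ, 0 < c ∧
    ∀ (Δ Δ' : Set (Site d)) (A B : Set (Config d)),
      MeasurableSet[cylEvents Δ] A → MeasurableSet[cylEvents Δ'] B → 0 < μ B →
      ENNReal.ofReal |(μ (A ∩ B) / μ B).toReal - (μ A).toReal| ≤
        ENNReal.ofReal C *
          ∑' (i : Δ) (j : Δ'), ENNReal.ofReal (Real.exp (-c * dist1 i.val j.val))

end IsingP

namespace IsingP

noncomputable def torusEnergy (d N : ℕ) [NeZero (2 * N)] (β h : ℝ)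
    (σ : (Fin d → ZMod (2 * N)) → Bool) : ℝ :=
  β * ∑ i : Fin d → ZMod (2 * N), ∑ k : Fin d,
      spin (σ i) * spin (σ (fun l => i l + if l = k then 1 else 0))
    + h * ∑ i : Fin d → ZMod (2 * N), spin (σ i)

noncomputable def torusZ (d : ℕ) (β h : ℝ) (N : ℕ) : ℝ :=
  if hN : 0 < N then
    haveI : NeZero (2 * N) := ⟨by omega⟩
    ∑ σ : (Fin d → ZMod (2 * N)) → Bool, Real.exp (torusEnergy d N β h σ)
  else 0

end IsingP

namespace IsingP

/-- Torus correlation `⟨σ_A⟩_{N,β,h}`, with `A ⊂ ℤ^d` identified with a subset of the torus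
`𝕋^d_N = (ℤ/2Nℤ)^d` via reduction mod `2N`. -/
noncomputable def torusCorr (d : ℕ) (A : Finset (Site d)) (β h : ℝ) (N : ℕ) : ℝ :=
  if hN : 0 < N then
    haveI : NeZero (2 * N) := ⟨by omega⟩
    (∑ σ : (Fin d → ZMod (2 * N)) → Bool,
        (∏ i ∈ A, spin (σ (fun k => ((i k : ℤ) : ZMod (2 * N))))) *
          Real.exp (torusEnergy d N β h σ)) /
      ∑ σ : (Fin d → ZMod (2 * N)) → Bool, Real.exp (torusEnergy d N β h σ)
  else 0

end IsingP

open MeasureTheory Filter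

namespace IsingP

section AvSec
variable {X Θ : Type*} [Fintype Θ]

/-- Weighted average over all labelings of the list `l`. -/
def Av {R : Type*} [CommSemiring R] (w : Θ → R) : List X → (List (X × Θ) → R) → R
  | [], G => G []
  | x :: l, G => ∑ u, w u * Av w l (fun L => G ((x, u) :: L))

section semiring
variable {R : Type*} [CommSemiring R] (w : Θ → R)

theorem Av_nil (G : List (X × Θ) → R) : Av w [] G = G [] := rfl
theorem Av_cons (x : X) (l : List X) (G : List (X × Θ) → R) :
    Av w (x :: l) G = ∑ u, w u * Av w l (fun L => G ((x, u) :: L)) := rfl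

theorem Av_append (l l' : List X) (G : List (X × Θ) → R) :
    Av w (l ++ l') G = Av w l (fun L => Av w l' (fun L' => G (L ++ L'))) := by
  induction l generalizing G with
  | nil => simp [Av_nil]
  | cons x l ih => simp [Av_cons, ih]

theorem Av_congr (l : List X) (G G' : List (X × Θ) → R)
    (h : ∀ L, L.map Prod.fst = l → G L = G' L) : Av w l G = Av w l G' := by
  induction l generalizing G G' with
  | nil => exact h [] rfl
  | cons x l ih =>
    rw [Av_cons, Av_cons]
    refine Finset.sum_congr rfl fun u _ => ?_
    rw [ih _ (fun L => G' ((x, u) :: L)) fun L hL => h _ (by simp [hL])]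

theorem Av_mul_left (l : List X) (c : R) (G : List (X × Θ) → R) :
    Av w l (fun L => c * G L) = c * Av w l G := by
  induction l generalizing G with
  | nil => rfl
  | cons x l ih =>
    rw [Av_cons, Av_cons, Finset.mul_sum]
    refine Finset.sum_congr rfl fun u _ => ?_
    rw [ih]; ring

theorem Av_sum {ι : Type*} (s : Finset ι) (l : List X) (G : ι → List (X × Θ) → R) :
    Av w l (fun L => ∑ i ∈ s, G i L) = ∑ i ∈ s, Av w l (G i) := by
  induction l generalizing G with
  | nil => rfl
  | cons x l ih =>
    simp only [Av_cons]
    rw [Finset.sum_comm]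
    refine Finset.sum_congr rfl fun u _ => ?_
    rw [ih, Finset.mul_sum]

theorem Av_add (l : List X) (G G' : List (X × Θ) → R) :
    Av w l (fun L => G L + G' L) = Av w l G + Av w l G' := by
  induction l generalizing G G' with
  | nil => rfl
  | cons x l ih =>
    simp only [Av_cons, ih, mul_add, Finset.sum_add_distrib]

theorem Av_const (l : List X) (c : R) :
    Av w l (fun _ : List (X × Θ) => c) = (∑ u, w u) ^ l.length * c := by
  induction l with
  | nil => simp [Av_nil]
  | cons x l ih =>
    rw [Av_cons, ih, ← Finset.sum_mul, List.length_cons, pow_succ]; ring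

theorem Av_factor (p : X → Bool) (l : List X) (G H : List (X × Θ) → R) :
    Av w l (fun L => G (L.filter (fun q => p q.1)) * H (L.filter (fun q => !p q.1))) =
      Av w (l.filter p) G * Av w (l.filter (fun x => !p x)) H := by
  induction l generalizing G H with
  | nil => rfl
  | cons x l ih =>
    rw [Av_cons]
    by_cases hx : p x
    · simp only [List.filter_cons, hx, Bool.not_true, if_true, Bool.false_eq_true, if_false, Av_cons]
      rw [Finset.sum_mul]
      refine Finset.sum_congr rfl fun u _ => ?_
      rw [ih (fun L => G ((x,u) :: L)) H]; ring
    · simp only [List.filter_cons, hx, Bool.not_false, if_true, Bool.false_eq_true, if_false, Av_cons]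
      rw [Finset.mul_sum]
      refine Finset.sum_congr rfl fun u _ => ?_
      rw [ih G (fun L => H ((x,u) :: L))]; ring

theorem Av_map {R' : Type*} [CommSemiring R'] (φ : R →+* R') (l : List X) (G : List (X × Θ) → R) :
    φ (Av w l G) = Av (fun u => φ (w u)) l (fun L => φ (G L)) := by
  induction l generalizing G with
  | nil => rfl
  | cons x l ih => simp [Av_cons, ih]

end semiring

theorem Av_mono {w : Θ → ℝ} (hw : ∀ u, 0 ≤ w u) (l : List X) (G G' : List (X × Θ) → ℝ)
    (h : ∀ L, L.map Prod.fst = l → G L ≤ G' L) : Av w l G ≤ Av w l G' := by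
  induction l generalizing G G' with
  | nil => exact h [] rfl
  | cons x l ih =>
    rw [Av_cons, Av_cons]
    refine Finset.sum_le_sum fun u _ => mul_le_mul_of_nonneg_left ?_ (hw u)
    exact ih _ (fun L => G' ((x, u) :: L)) fun L hL => h _ (by simp [hL])

theorem Av_nonneg {w : Θ → ℝ} (hw : ∀ u, 0 ≤ w u) (l : List X) (G : List (X × Θ) → ℝ)
    (h : ∀ L, L.map Prod.fst = l → 0 ≤ G L) : 0 ≤ Av w l G := by
  have := Av_mono hw l (fun _ => 0) G h
  rwa [Av_const, mul_zero] at this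

theorem Av_norm_le {w : Θ → ℂ} {w' : Θ → ℝ} (hw : ∀ u, ‖w u‖ ≤ w' u) (l : List X)
    (G : List (X × Θ) → ℂ) (G' : List (X × Θ) → ℝ)
    (h : ∀ L, L.map Prod.fst = l → ‖G L‖ ≤ G' L) : ‖Av w l G‖ ≤ Av w' l G' := by
  induction l generalizing G G' with
  | nil => exact h [] rfl
  | cons x l ih =>
    rw [Av_cons, Av_cons]
    refine (norm_sum_le _ _).trans (Finset.sum_le_sum fun u _ => ?_)
    rw [norm_mul]
    refine mul_le_mul (hw u) ?_ (norm_nonneg _) ((norm_nonneg _).trans (hw u))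
    exact ih _ (fun L => G' ((x, u) :: L)) fun L hL => h _ (by simp [hL])

theorem Av_differentiableOn {E : Type*} [NormedAddCommGroup E] [NormedSpace ℂ E] {s : Set E}
    {w : E → Θ → ℂ} (hw : ∀ u, DifferentiableOn ℂ (fun p => w p u) s) (l : List X)
    (G : E → List (X × Θ) → ℂ)
    (h : ∀ L, DifferentiableOn ℂ (fun p => G p L) s) :
    DifferentiableOn ℂ (fun p => Av (w p) l (G p)) s := by
  induction l generalizing G with
  | nil => exact h []
  | cons x l ih =>
    simp only [Av_cons]
    refine DifferentiableOn.fun_sum fun u _ => (hw u).mul (ih (fun p L => G p ((x, u) :: L)) ?_)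
    intro L; exact h _

/-- comparison of nearby weights -/
theorem Av_le_add {w w' : Θ → ℝ} (hw : ∀ u, 0 ≤ w u) (hww : ∀ u, w u ≤ w' u) (h1 : ∑ u, w u = 1)
    (l : List X)
    (G : List (X × Θ) → ℝ) (h0 : ∀ L, L.map Prod.fst = l → G L ≤ 1) :
    Av w' l G ≤ Av w l G + ((∑ u, w' u) ^ l.length - 1) := by
  have key : ∀ (l : List X) (H : List (X × Θ) → ℝ),
    (∀ L, L.map Prod.fst = l → 0 ≤ H L) → Av w l H ≤ Av w' l H := by
    intro l
    induction l with
    | nil => intro H _; exact le_rfl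
    | cons x l ih =>
      intro H hH
      rw [Av_cons, Av_cons]
      have hH' : ∀ u, ∀ L : List (X × Θ), L.map Prod.fst = l → 0 ≤ H ((x,u) :: L) :=
        fun u L hL => hH _ (by simp [hL])
      refine Finset.sum_le_sum fun u _ => mul_le_mul (hww u) (ih _ (hH' u))
        (Av_nonneg hw _ _ (hH' u)) ((hw u).trans (hww u))
  have := key l (fun L => 1 + (-1) * G L) (fun L hL => by linarith [h0 L hL])
  rw [Av_add, Av_add, Av_const, Av_const, Av_mul_left, Av_mul_left, h1, one_pow] at this
  linarith

/-- product bound over disjoint regions -/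
theorem Av_prod_le {ι : Type*} {w : Θ → ℝ} (hw : ∀ u, 0 ≤ w u) (h1 : 1 ≤ ∑ u, w u)
    (T : Finset ι) (Y : ι → X → Bool)
    (hdis : ∀ i ∈ T, ∀ j ∈ T, i ≠ j → ∀ x, Y i x = true → Y j x = false)
    (b : ι → List (X × Θ) → ℝ) (hb : ∀ i L, 0 ≤ b i L) (ε : ℝ)
    (l : List X) (hε : ∀ i ∈ T, Av w (l.filter (Y i)) (b i) ≤ ε) (hε0 : 0 ≤ ε) :
    Av w l (fun L => ∏ i ∈ T, b i (L.filter (fun q => Y i q.1))) ≤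
      ε ^ T.card * (∑ u, w u) ^ l.length := by
  classical
  induction T using Finset.induction_on generalizing l with
  | empty => simp [Av_const]
  | insert i T hi ih =>
    have hfil0 : ∀ j ∈ T, ∀ x, (Y j x && !Y i x) = Y j x := by
      intro j hj x
      have := hdis j (Finset.mem_insert_of_mem hj) i (Finset.mem_insert_self _ _)
        (fun h => hi (h ▸ hj)) x
      cases h1 : Y j x <;> simp_all
    have hfil : ∀ j ∈ T, ∀ L : List (X × Θ),
        (L.filter (fun q => !Y i q.1)).filter (fun q => Y j q.1) = L.filter (fun q => Y j q.1) := by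
      intro j hj L
      rw [List.filter_filter]
      exact List.filter_congr fun q _ => hfil0 j hj q.1
    have hfil' : ∀ j ∈ T, ∀ L : List X,
        (L.filter (fun q => !Y i q)).filter (Y j) = L.filter (Y j) := by
      intro j hj L
      rw [List.filter_filter]
      exact List.filter_congr fun q _ => hfil0 j hj q
    have e1 : Av w l (fun L => ∏ i ∈ insert i T, b i (L.filter (fun q => Y i q.1))) =
        Av w l (fun L => b i (L.filter (fun q => Y i q.1)) *
          (fun L' => ∏ j ∈ T, b j (L'.filter (fun q => Y j q.1))) (L.filter (fun q => !Y i q.1))) := by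
      congr 1
      funext L
      rw [Finset.prod_insert hi]
      congr 1
      refine Finset.prod_congr rfl fun j hj => ?_
      rw [hfil j hj]
    have e2 := Av_factor w (Y i) l (b i) (fun L' => ∏ j ∈ T, b j (L'.filter (fun q => Y j q.1)))
    rw [e1, e2, Finset.card_insert_of_notMem hi]
    have i1 := ih (fun a ha c hc => hdis a (Finset.mem_insert_of_mem ha) c (Finset.mem_insert_of_mem hc))
      (l.filter (fun x => !Y i x)) (fun j hj => by
        rw [hfil' j hj]
        exact hε j (Finset.mem_insert_of_mem hj))
    calc _ ≤ ε * (ε ^ T.card * (∑ u, w u) ^ (l.filter (fun x => !Y i x)).length) :=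
          mul_le_mul (hε i (Finset.mem_insert_self _ _)) i1
            (Av_nonneg hw _ _ fun L _ => Finset.prod_nonneg fun j _ => hb _ _) hε0
      _ ≤ ε * (ε ^ T.card * (∑ u, w u) ^ l.length) := by
          gcongr
          · exact List.length_filter_le _ _
      _ = _ := by ring

end AvSec

section Dyn
variable {d : ℕ}

abbrev Th (d : ℕ) := Fin (2 * d + 2)

def cnt (ω : Config d) (x : Site d) : ℕ := ((nbrs x).filter (fun y => ω y = true)).card

def upd (x : Site d) (u : Th d) (ω : Config d) : Config d :=
  Function.update ω x (decide ((u : ℕ) ≤ cnt ω x))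

def Phi (L : List (Site d × Th d)) (ω : Config d) : Config d :=
  L.foldl (fun ω q => upd q.1 q.2 ω) ω

theorem Phi_nil (ω : Config d) : Phi [] ω = ω := rfl
theorem Phi_cons (q : Site d × Th d) (L) (ω : Config d) : Phi (q :: L) ω = Phi L (upd q.1 q.2 ω) := rfl
theorem Phi_append (L L' : List (Site d × Th d)) (ω : Config d) :
    Phi (L ++ L') ω = Phi L' (Phi L ω) := by simp [Phi]

theorem nbrs_card (x : Site d) : (nbrs x).card = 2 * d := by
  unfold nbrs
  rw [Finset.card_image_of_injective]
  · simp [mul_comm]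
  · rintro ⟨k, b⟩ ⟨k', b'⟩ h
    have h1 := congrFun h k
    simp only [if_true] at h1
    have : k = k' := by
      by_contra hne
      rw [if_neg hne] at h1
      cases b <;> simp at h1
    subst this
    simp at h1
    cases b <;> cases b' <;> simp at h1 ⊢

theorem cnt_le (ω : Config d) (x : Site d) : cnt ω x ≤ 2 * d :=
  (Finset.card_filter_le _ _).trans (nbrs_card x).le

theorem not_mem_nbrs (x : Site d) : x ∉ nbrs x := by
  intro h
  simp only [nbrs, Finset.mem_image, Finset.mem_univ, true_and] at h
  obtain ⟨⟨k, b⟩, h⟩ := h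
  have h1 := congrFun h k
  simp at h1
  cases b <;> simp at h1

theorem cnt_congr {ω ω' : Config d} {x : Site d} (h : ∀ y ∈ nbrs x, ω y = ω' y) :
    cnt ω x = cnt ω' x := by
  unfold cnt
  congr 1
  exact Finset.filter_congr fun y hy => by rw [h y hy]

theorem cnt_mono {ω ω' : Config d} (h : ω ≤ ω') (x : Site d) : cnt ω x ≤ cnt ω' x := by
  unfold cnt
  apply Finset.card_le_card
  intro y
  simp only [Finset.mem_filter]
  rintro ⟨h1, h2⟩
  refine ⟨h1, ?_⟩
  have := h y
  rw [h2] at this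
  exact Bool.eq_true_of_true_le this

theorem upd_mono (x : Site d) (u : Th d) {ω ω' : Config d} (h : ω ≤ ω') :
    upd x u ω ≤ upd x u ω' := by
  intro y
  unfold upd
  by_cases hy : y = x
  · subst hy
    simp only [Function.update_self]
    have := cnt_mono h y
    by_cases h1 : (u : ℕ) ≤ cnt ω y
    · have := h1.trans this
      simp [*]
    · simp [h1]
  · simp only [Function.update_of_ne hy]; exact h y

theorem Phi_mono (L : List (Site d × Th d)) {ω ω' : Config d} (h : ω ≤ ω') : Phi L ω ≤ Phi L ω' := by
  induction L generalizing ω ω' with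
  | nil => exact h
  | cons q L ih => exact ih (upd_mono _ _ h)

/-- locality of a function of the configuration -/
def Loc {α : Type*} (s : Set (Site d)) (f : Config d → α) : Prop :=
  ∀ ω ω', (∀ x ∈ s, ω x = ω' x) → f ω = f ω'

theorem Loc.mono {α : Type*} {s t : Set (Site d)} {f : Config d → α} (h : Loc s f) (hst : s ⊆ t) :
    Loc t f := fun ω ω' hh => h ω ω' fun x hx => hh x (hst hx)

theorem upd_eq_off (x : Site d) (u : Th d) (ω : Config d) {y : Site d} (hy : y ≠ x) :
    upd x u ω y = ω y := by simp [upd, hy]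

theorem Phi_eq_off (L : List (Site d × Th d)) (ω : Config d) {y : Site d}
    (hy : y ∉ L.map Prod.fst) : Phi L ω y = ω y := by
  induction L generalizing ω with
  | nil => rfl
  | cons q L ih =>
    simp only [List.map_cons, List.mem_cons, not_or] at hy
    rw [Phi_cons, ih _ hy.2, upd_eq_off _ _ _ hy.1]

/-- If every update inside `Y` has its neighbours in `Y`, the dynamics on `Y` is autonomous. -/
theorem Phi_closed (Y : Site d → Bool) (L : List (Site d × Th d))
    (hL : ∀ x ∈ L.map Prod.fst, Y x = true → ∀ y ∈ nbrs x, Y y = true)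
    (ω ω' : Config d) (h : ∀ x, Y x = true → ω x = ω' x) :
    ∀ x, Y x = true → Phi L ω x = Phi (L.filter (fun q => Y q.1)) ω' x := by
  induction L generalizing ω ω' with
  | nil => exact h
  | cons q L ih =>
    have hL' : ∀ x ∈ L.map Prod.fst, Y x = true → ∀ y ∈ nbrs x, Y y = true :=
      fun x hx => hL x (by simp only [List.map_cons, List.mem_cons]; exact Or.inr hx)
    by_cases hq : Y q.1
    · rw [List.filter_cons, if_pos hq]
      simp only [Phi_cons]
      refine ih hL' _ _ ?_
      intro x hx
      unfold upd
      by_cases hxq : x = q.1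
      · subst hxq
        simp only [Function.update_self]
        rw [cnt_congr fun y hy => h y (hL q.1 (by simp) hq y hy)]
      · simp only [Function.update_of_ne hxq]; exact h x hx
    · rw [List.filter_cons, if_neg hq]
      rw [Phi_cons]
      refine ih hL' _ _ ?_
      intro x hx
      rw [upd_eq_off _ _ _ (y := x) (fun hxq : x = q.1 => hq (hxq ▸ hx))]
      exact h x hx

/-- averaged dynamics -/
def Pop {R : Type*} [CommSemiring R] (w : Th d → R) (l : List (Site d)) (f : Config d → R) :
    Config d → R := fun ω => Av w l (fun L => f (Phi L ω))

theorem Pop_append {R : Type*} [CommSemiring R] (w : Th d → R) (l l' : List (Site d))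
    (f : Config d → R) : Pop w (l ++ l') f = Pop w l (Pop w l' f) := by
  funext ω
  simp [Pop, Av_append, Phi_append]

theorem Pop_nil {R : Type*} [CommSemiring R] (w : Th d → R) (f : Config d → R) :
    Pop w [] f = f := rfl

theorem Pop_cons {R : Type*} [CommSemiring R] (w : Th d → R) (x : Site d) (l) (f : Config d → R) :
    Pop w (x :: l) f = Pop w [x] (Pop w l f) := Pop_append w [x] l f

theorem Pop_single {R : Type*} [CommSemiring R] (w : Th d → R) (x : Site d) (f : Config d → R)
    (ω) : Pop w [x] f ω = ∑ u, w u * f (upd x u ω) := rfl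

theorem Pop_loc_single {R : Type*} [CommSemiring R] (w : Th d → R) (x : Site d) (f : Config d → R)
    (s : Set (Site d)) (hf : Loc s f) : Loc (s ∪ nbrs x) (Pop w [x] f) := by
  intro ω ω' h
  simp only [Pop_single]
  refine Finset.sum_congr rfl fun u _ => ?_
  congr 1
  refine hf _ _ fun y hy => ?_
  unfold upd
  rw [cnt_congr fun y hy => h y (Or.inr hy)]
  by_cases hyx : y = x
  · subst hyx; simp
  · simp only [Function.update_of_ne hyx]; exact h y (Or.inl hy)

end Dyn
end IsingP

open MeasureTheory Filter

namespace IsingP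
section Wt
variable {d : ℕ}

/-- cumulative function -/
def Qf {R : Type*} [CommRing R] (d : ℕ) (Pr : ℕ → R) : ℕ → R
  | 0 => 0
  | j + 1 => if j = 2 * d + 1 then 1 else Pr j

def wt {R : Type*} [CommRing R] (d : ℕ) (Pr : ℕ → R) (u : Th d) : R :=
  Qf d Pr (u + 1) - Qf d Pr u

theorem wt_sum {R : Type*} [CommRing R] (Pr : ℕ → R) : ∑ u, wt d Pr u = 1 := by
  have := Fin.sum_univ_eq_sum_range (fun u => Qf d Pr (u + 1) - Qf d Pr u) (2 * d + 2)
  simp only [wt]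
  rw [this, Finset.sum_range_sub]
  simp [Qf]

theorem wt_split {R : Type*} [CommRing R] (Pr : ℕ → R) (k : ℕ) (hk : k ≤ 2 * d) (F : Bool → R) :
    ∑ u : Th d, wt d Pr u * F (decide ((u : ℕ) ≤ k)) = Pr k * F true + (1 - Pr k) * F false := by
  have h1 : ∀ u : Th d, wt d Pr u * F (decide ((u : ℕ) ≤ k)) =
      wt d Pr u * F false + (if (u : ℕ) ≤ k then wt d Pr u else 0) * (F true - F false) := by
    intro u
    by_cases h : (u : ℕ) ≤ k <;> simp [h]
    ring
  have h2 : ∑ u : Th d, (if (u : ℕ) ≤ k then wt d Pr u else 0) = Pr k := by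
    have := Fin.sum_univ_eq_sum_range (fun u => if u ≤ k then Qf d Pr (u + 1) - Qf d Pr u else 0)
      (2 * d + 2)
    simp only [wt]
    rw [this, ← Finset.sum_filter]
    have : (Finset.range (2 * d + 2)).filter (fun u => u ≤ k) = Finset.range (k + 1) := by
      ext u; simp; omega
    rw [this, Finset.sum_range_sub]
    simp [Qf]; omega
  simp only [h1, Finset.sum_add_distrib, ← Finset.sum_mul, wt_sum, h2]
  ring

theorem Pop_wt {R : Type*} [CommRing R] (Pr : ℕ → R) (x : Site d) (f : Config d → R) (ω) :
    Pop (wt d Pr) [x] f ω = Pr (cnt ω x) * f (Function.update ω x true) +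
      (1 - Pr (cnt ω x)) * f (Function.update ω x false) := by
  rw [Pop_single]
  exact wt_split Pr (cnt ω x) (cnt_le ω x) (fun b => f (Function.update ω x b))

noncomputable def prR (d : ℕ) (β h : ℝ) (k : ℕ) : ℝ :=
  Real.exp (β * (2 * k - 2 * d) + h) /
    (Real.exp (β * (2 * k - 2 * d) + h) + Real.exp (-(β * (2 * k - 2 * d) + h)))

noncomputable def prC (d : ℕ) (p : ℂ × ℂ) (k : ℕ) : ℂ :=
  Complex.exp (p.1 * (2 * k - 2 * d) + p.2) /
    (Complex.exp (p.1 * (2 * k - 2 * d) + p.2) + Complex.exp (-(p.1 * (2 * k - 2 * d) + p.2)))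

theorem prC_ofReal (β h : ℝ) (k : ℕ) : prC d ((β : ℂ), (h : ℂ)) k = (prR d β h k : ℂ) := by
  simp [prC, prR]

noncomputable abbrev wR (d : ℕ) (β h : ℝ) : Th d → ℝ := wt d (prR d β h)
noncomputable abbrev wC (d : ℕ) (p : ℂ × ℂ) : Th d → ℂ := wt d (prC d p)

theorem wC_ofReal (β h : ℝ) (u : Th d) : wC d ((β : ℂ), (h : ℂ)) u = (wR d β h u : ℂ) := by
  have : ∀ j, Qf d (prC d ((β : ℂ), (h : ℂ))) j = ((Qf d (prR d β h) j : ℝ) : ℂ) := by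
    intro j
    cases j with
    | zero => simp [Qf]
    | succ j =>
      simp only [Qf]
      split_ifs
      · simp
      · exact prC_ofReal _ _ _
  simp only [wC, wt, this]
  simp [wR, wt]

theorem prR_pos (β h : ℝ) (k : ℕ) : 0 < prR d β h k := by
  unfold prR; positivity

theorem prR_lt_one (β h : ℝ) (k : ℕ) : prR d β h k < 1 := by
  unfold prR
  rw [div_lt_one (by positivity)]
  linarith [Real.exp_pos (-(β * (2 * k - 2 * d) + h))]

theorem prR_mono (β h : ℝ) (hβ : 0 ≤ β) {k k' : ℕ} (hk : k ≤ k') : prR d β h k ≤ prR d β h k' := by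
  unfold prR
  have hk' : (k : ℝ) ≤ k' := by exact_mod_cast hk
  have h1 : β * (2 * k - 2 * d) + h ≤ β * (2 * k' - 2 * d) + h := by nlinarith
  generalize β * (2 * k - 2 * d) + h = a at *
  generalize β * (2 * k' - 2 * d) + h = b at *
  rw [div_le_div_iff₀ (by positivity) (by positivity)]
  have : Real.exp a * Real.exp (-b) ≤ Real.exp b * Real.exp (-a) := by
    rw [← Real.exp_add, ← Real.exp_add]
    apply Real.exp_le_exp.2; linarith
  nlinarith

theorem wR_nonneg (β h : ℝ) (hβ : 0 ≤ β) (u : Th d) : 0 ≤ wR d β h u := by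
  unfold wR wt
  rcases u with ⟨u, hu⟩
  simp only
  cases u with
  | zero => simp [Qf]; exact (prR_pos _ _ _).le
  | succ u =>
    simp only [Qf]
    rw [if_neg (by omega : ¬ u = 2 * d + 1)]
    split_ifs
    · linarith [prR_lt_one (d := d) β h u]
    · linarith [prR_mono (d := d) β h hβ (Nat.le_succ u)]

theorem wR_zero_pos (β h : ℝ)  : 0 < wR d β h 0 := by
  simp [wR, wt, Qf]; exact prR_pos _ _ _

theorem wR_last_pos (β h : ℝ)  : 0 < wR d β h (Fin.last _) := by
  simp [wR, wt, Qf]; exact prR_lt_one _ _ _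

theorem wC_good (β₀ h₀ : ℝ) (δ : ℝ) (hδ : 0 < δ) (hβ : 0 ≤ β₀) :
    ∃ r > 0, (∀ u, DifferentiableOn ℂ (fun p => wC d p u) (Metric.ball ((β₀ : ℂ), (h₀ : ℂ)) r)) ∧
      ∀ p ∈ Metric.ball ((β₀ : ℂ), (h₀ : ℂ)) r, ∀ u, ‖wC d p u‖ ≤ wR d β₀ h₀ u + δ := by
  set p₀ : ℂ × ℂ := ((β₀ : ℂ), (h₀ : ℂ))
  -- differentiability at p₀ eventually
  have hden : ∀ k : ℕ, ∀ᶠ p in nhds p₀, (Complex.exp (p.1 * (2 * k - 2 * d) + p.2) + Complex.exp (-(p.1 * (2 * k - 2 * d) + p.2))) ≠ 0 := by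
    intro k
    have hc : ContinuousAt (fun p : ℂ × ℂ => (Complex.exp (p.1 * (2 * k - 2 * d) + p.2) + Complex.exp (-(p.1 * (2 * k - 2 * d) + p.2)))) p₀ := by
      fun_prop
    apply hc.eventually_ne
    have : (Complex.exp (p₀.1 * (2 * k - 2 * d) + p₀.2) + Complex.exp (-(p₀.1 * (2 * k - 2 * d) + p₀.2))) = ((Real.exp (β₀ * (2 * k - 2 * d) + h₀) + Real.exp (-(β₀ * (2 * k - 2 * d) + h₀)) : ℝ) : ℂ) := by
      simp [p₀]
    rw [this]
    norm_cast
    positivity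
  have hpr : ∀ k : ℕ, ∀ᶠ p in nhds p₀, DifferentiableAt ℂ (fun p => prC d p k) p := by
    intro k
    filter_upwards [hden k] with p hp
    unfold prC
    have a1 : DifferentiableAt ℂ (fun p : ℂ × ℂ => Complex.exp (p.1 * (2 * k - 2 * d) + p.2)) p := by
      fun_prop
    have a2 : DifferentiableAt ℂ (fun p : ℂ × ℂ => Complex.exp (p.1 * (2 * k - 2 * d) + p.2) +
      Complex.exp (-(p.1 * (2 * k - 2 * d) + p.2))) p := by
      fun_prop
    simp only [div_eq_mul_inv]
    exact a1.mul (a2.fun_inv hp)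
  have hQ : ∀ k : ℕ, ∀ᶠ p in nhds p₀, DifferentiableAt ℂ (fun p => Qf d (prC d p) k) p := by
    intro k
    cases k with
    | zero => simp [Qf]
    | succ k =>
      simp only [Qf]
      split_ifs
      · simp
      · exact hpr k
  have hw : ∀ u, ∀ᶠ p in nhds p₀, DifferentiableAt ℂ (fun p => wC d p u) p := by
    intro u
    filter_upwards [hQ (u + 1), hQ u] with p h1 h2
    exact h1.sub h2
  have hb : ∀ u, ∀ᶠ p in nhds p₀, ‖wC d p u‖ ≤ wR d β₀ h₀ u + δ := by
    intro u
    have hc : ContinuousAt (fun p => ‖wC d p u‖) p₀ := (hw u).self_of_nhds.continuousAt.norm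
    have : ‖wC d p₀ u‖ < wR d β₀ h₀ u + δ := by
      rw [wC_ofReal, Complex.norm_real, Real.norm_of_nonneg (wR_nonneg _ _ hβ _)]; linarith
    filter_upwards [hc.eventually_lt_const this] with p hp using hp.le
  have := (eventually_all.2 hw).and (eventually_all.2 hb)
  obtain ⟨r, hr, h⟩ := Metric.eventually_nhds_iff_ball.1 this
  exact ⟨r, hr, fun u p hp => ((h p hp).1 u).differentiableWithinAt, fun p hp => (h p hp).2⟩

end Wt
end IsingP

open MeasureTheory Filter

namespace IsingP
section Torus
variable {d : ℕ}

def redm (N : ℕ) (x : Site d) : Fin d → ZMod (2 * N) := fun k => ((x k : ℤ) : ZMod (2 * N))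

def per (N : ℕ) (σ : (Fin d → ZMod (2 * N)) → Bool) : Config d := fun x => σ (redm N x)

noncomputable def nuT (d N : ℕ) [NeZero (2 * N)] (β h : ℝ) (g : Config d → ℂ) : ℂ :=
  (∑ σ : (Fin d → ZMod (2 * N)) → Bool, g (per N σ) * (Real.exp (torusEnergy d N β h σ) : ℂ)) /
    ∑ σ : (Fin d → ZMod (2 * N)) → Bool, (Real.exp (torusEnergy d N β h σ) : ℂ)

theorem spin_sum (ω : Config d) (x : Site d) :
    ∑ y ∈ nbrs x, spin (ω y) = 2 * cnt ω x - 2 * d := by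
  have h1 : ∀ y, spin (ω y) = 2 * (if ω y = true then 1 else 0) - 1 := by
    intro y; unfold spin; split_ifs <;> norm_num
  simp only [h1, Finset.sum_sub_distrib, ← Finset.mul_sum, Finset.sum_boole]
  simp [nbrs_card, cnt]

theorem nbrs_sum {M : Type*} [AddCommMonoid M] (x : Site d) (F : Site d → M) :
    ∑ y ∈ nbrs x, F y = ∑ k : Fin d,
      (F (fun l => if l = k then x l + 1 else x l) + F (fun l => if l = k then x l + -1 else x l)) := by
  unfold nbrs
  rw [Finset.sum_image]
  · rw [Fintype.sum_prod_type]
    refine Finset.sum_congr rfl fun k _ => ?_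
    simp
  · have hc : (Finset.univ.image
    (fun q : Fin d × Bool => fun k => if k = q.1 then x k + (if q.2 then 1 else -1) else x k)).card =
      (Finset.univ : Finset (Fin d × Bool)).card := by
      have := nbrs_card x
      unfold nbrs at this
      rw [this]; simp [mul_comm]
    exact Finset.card_image_iff.1 hc

theorem energy_diff (N : ℕ) [NeZero (2 * N)] (β h : ℝ) (σ : (Fin d → ZMod (2 * N)) → Bool)
    (x : Site d) (hN : 0 < N) :
    torusEnergy d N β h (Function.update σ (redm N x) true) -
    torusEnergy d N β h (Function.update σ (redm N x) false) =
      2 * (β * (2 * cnt (per N σ) x - 2 * d) + h) := by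
  classical
  haveI : Fact (1 < 2 * N) := ⟨by omega⟩
  rw [← spin_sum, nbrs_sum]
  have hx : ∀ k : Fin d, redm N x ≠ (fun l => redm N x l + if l = k then 1 else 0) := by
    intro k hk
    have := congrFun hk k
    simp at this
  have hp : ∀ k : Fin d, per N σ (fun l => if l = k then x l + 1 else x l) =
      σ (fun l => redm N x l + if l = k then 1 else 0) := by
    intro k
    unfold per; congr 1; funext l; unfold redm; split_ifs <;> simp [*]
  have hm : ∀ k : Fin d, per N σ (fun l => if l = k then x l + -1 else x l) =
      σ (fun l => redm N x l - if l = k then 1 else 0) := by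
    intro k
    unfold per; congr 1; funext l; unfold redm; split_ifs <;> simp [*, sub_eq_add_neg]
  simp only [hp, hm]
  generalize redm N x = X at *
  have hi : ∀ (k : Fin d) (i : Fin d → ZMod (2 * N)),
     (spin (Function.update σ X true i) * spin (Function.update σ X true (fun l => i l + if l = k then 1 else 0)) -
      spin (Function.update σ X false i) * spin (Function.update σ X false (fun l => i l + if l = k then 1 else 0)))
      = (if i = X then 2 * spin (σ (fun l => X l + if l = k then 1 else 0)) else 0) +
        (if i = (fun l => X l - if l = k then 1 else 0) then 2 * spin (σ (fun l => X l - if l = k then 1 else 0)) else 0) := by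
    intro k i
    by_cases h1 : i = X
    · subst h1
      have h2 : ¬ (i = (fun l => i l - if l = k then 1 else 0)) := by
        intro hk
        have := congrFun hk k
        simp [eq_sub_iff_add_eq] at this
      rw [if_pos rfl, if_neg h2, Function.update_self, Function.update_self,
        Function.update_of_ne (hx k).symm, Function.update_of_ne (hx k).symm]
      simp only [spin]; split_ifs <;> simp_all <;> norm_num
    · rw [Function.update_of_ne h1, Function.update_of_ne h1, if_neg h1]
      by_cases h2 : i = (fun l => X l - if l = k then 1 else 0)
      · have h3 : (fun l => i l + if l = k then 1 else 0) = X := by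
          rw [h2]; funext l; simp
        rw [h3, if_pos h2, Function.update_self, Function.update_self, ← h2]
        simp only [spin]; split_ifs <;> simp_all <;> norm_num
      · have h3 : (fun l => i l + if l = k then 1 else 0) ≠ X := by
          intro h3; apply h2; rw [← h3]; funext l; simp
        rw [Function.update_of_ne h3, Function.update_of_ne h3, if_neg h2]; ring
  have hs : ∑ i, spin (Function.update σ X true i) - ∑ i, spin (Function.update σ X false i) = 2 := by
    rw [← Finset.sum_sub_distrib, Finset.sum_eq_single X]
    · simp [spin]; norm_num
    · intro b _ hb
      simp [Function.update_of_ne hb]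
    · simp
  have hk : ∑ i : Fin d → ZMod (2 * N), ∑ k : Fin d,
      spin (Function.update σ X true i) * spin (Function.update σ X true (fun l => i l + if l = k then 1 else 0)) -
      ∑ i : Fin d → ZMod (2 * N), ∑ k : Fin d,
      spin (Function.update σ X false i) * spin (Function.update σ X false (fun l => i l + if l = k then 1 else 0)) =
      2 * ∑ k : Fin d, (spin (σ (fun l => X l + if l = k then 1 else 0)) + spin (σ (fun l => X l - if l = k then 1 else 0))) := by
    rw [← Finset.sum_sub_distrib]
    simp only [← Finset.sum_sub_distrib, hi]
    rw [Finset.sum_comm, Finset.mul_sum]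
    refine Finset.sum_congr rfl fun k _ => ?_
    rw [Finset.sum_add_distrib, Finset.sum_ite_eq' , Finset.sum_ite_eq']
    simp; ring
  unfold torusEnergy
  linear_combination β * hk + h * hs

theorem torus_inv (N : ℕ) [NeZero (2 * N)] (β h : ℝ) (x : Site d) (hN : 0 < N) (S : Set (Site d))
    (hS : ∀ y ∈ S, redm N y = redm N x → y = x) (g : Config d → ℂ) (hg : Loc S g) :
    nuT d N β h (Pop (wC d ((β : ℂ), (h : ℂ))) [x] g) = nuT d N β h g := by
  classical
  haveI : Fact (1 < 2 * N) := ⟨by omega⟩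
  unfold nuT
  congr 1
  set X := redm N x with hX
  have pair : ∀ H : ((Fin d → ZMod (2 * N)) → Bool) → ℂ,
      2 * ∑ σ, H σ = ∑ σ, (H (Function.update σ X true) + H (Function.update σ X false)) := by
    intro H
    have hinv : Function.Involutive (fun σ : (Fin d → ZMod (2 * N)) → Bool => Function.update σ X (!σ X)) := by
      intro σ
      simp
    have h1 : ∑ σ, H (Function.update σ X (!σ X)) = ∑ σ, H σ :=
      Equiv.sum_comp (hinv.toPerm) H
    rw [two_mul]
    nth_rewrite 2 [← h1]
    rw [← Finset.sum_add_distrib]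
    refine Finset.sum_congr rfl fun σ _ => ?_
    cases hσ : σ X
    · have : Function.update σ X false = σ := by rw [← hσ]; simp
      rw [this]; simp [add_comm]
    · have : Function.update σ X true = σ := by rw [← hσ]; simp
      rw [this]; simp
  have two : (2 : ℂ) ≠ 0 := two_ne_zero
  apply mul_left_cancel₀ two
  rw [pair, pair]
  refine Finset.sum_congr rfl fun σ _ => ?_
  have hcnt : ∀ b, cnt (per N (Function.update σ X b)) x = cnt (per N σ) x := by
    intro b
    apply cnt_congr
    intro y hy
    unfold per
    rw [Function.update_of_ne]
    simp only [nbrs, Finset.mem_image, Finset.mem_univ, true_and] at hy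
    obtain ⟨⟨k, c⟩, rfl⟩ := hy
    intro h
    have := congrFun h k
    simp only [redm, hX] at this
    cases c <;> simp at this
  have hgu : ∀ b c, g (Function.update (per N (Function.update σ X b)) x c) = g (per N (Function.update σ X c)) := by
    intro b c
    apply hg
    intro y hy
    by_cases hyx : y = x
    · subst hyx
      simp [per, hX]
    · have : redm N y ≠ X := fun h => hyx (hS y hy h)
      rw [Function.update_of_ne hyx]
      simp only [per]
      rw [Function.update_of_ne this, Function.update_of_ne this]
  rw [Pop_wt, Pop_wt, hcnt, hcnt, hgu, hgu, hgu, hgu, prC_ofReal]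
  set k := cnt (per N σ) x with hk
  have hE := energy_diff N β h σ x hN
  rw [← hk, ← hX] at hE
  set Ep := torusEnergy d N β h (Function.update σ X true)
  set Em := torusEnergy d N β h (Function.update σ X false)
  have hpr : prR d β h k * (Real.exp Ep + Real.exp Em) = Real.exp Ep := by
    unfold prR
    set θ := β * (2 * k - 2 * d) + h
    have e1 : Real.exp Ep = Real.exp (Em + θ) * Real.exp θ := by
      rw [← Real.exp_add]; congr 1; linarith
    have e2 : Real.exp Em = Real.exp (Em + θ) * Real.exp (-θ) := by
      rw [← Real.exp_add]; congr 1; ring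
    have hne : Real.exp θ + Real.exp (-θ) ≠ 0 := by positivity
    rw [e1, show Real.exp (Em + θ) * Real.exp θ + Real.exp Em =
      Real.exp (Em + θ) * (Real.exp θ + Real.exp (-θ)) by rw [mul_add, ← e2]]
    field_simp
  have hprC : (prR d β h k : ℂ) * ((Real.exp Ep : ℂ) + (Real.exp Em : ℂ)) = (Real.exp Ep : ℂ) := by
    exact_mod_cast hpr
  linear_combination (g (per N (Function.update σ X true)) - g (per N (Function.update σ X false))) * hprC

theorem redm_eventually (S : Set (Site d)) (hS : S.Finite) (x : Site d) :
    ∀ᶠ N : ℕ in atTop, ∀ y ∈ S, redm N y = redm N x → y = x := by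
  have : ∀ y ∈ S, ∀ᶠ N : ℕ in atTop, redm N y = redm N x → y = x := by
    intro y _
    have h1 : ∀ k : Fin d, ∀ᶠ N : ℕ in atTop, (((y k : ℤ) : ZMod (2 * N)) = ((x k : ℤ) : ZMod (2 * N))) → y k = x k := by
      intro k
      filter_upwards [eventually_gt_atTop (x k - y k).natAbs] with N hN hh
      rw [ZMod.intCast_eq_intCast_iff_dvd_sub] at hh
      have := Int.eq_zero_of_abs_lt_dvd hh (by rw [Int.abs_eq_natAbs]; omega)
      omega
    filter_upwards [eventually_all.2 h1] with N hN hh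
    funext k
    exact hN k (congrFun hh k)
  exact (hS.eventually_all).2 this

theorem Pop_loc {R : Type*} [CommSemiring R] (l : List (Site d)) (S : Set (Site d)) (hS : S.Finite) :
    ∃ S' : Set (Site d), S'.Finite ∧ ∀ (w : Th d → R) (g : Config d → R), Loc S g → Loc S' (Pop w l g) := by
  induction l with
  | nil => exact ⟨S, hS, fun w g h => h⟩
  | cons x l ih =>
    obtain ⟨S', h1, h2⟩ := ih
    refine ⟨S' ∪ nbrs x, h1.union (Finset.finite_toSet _), fun w g h => ?_⟩
    rw [Pop_cons]
    exact Pop_loc_single _ _ _ _ (h2 w g h)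

noncomputable def nuN (d N : ℕ) (β h : ℝ) (g : Config d → ℂ) : ℂ :=
  if hN : 0 < N then
    haveI : NeZero (2 * N) := ⟨by omega⟩
    nuT d N β h g
  else 0

theorem nuN_inv (l : List (Site d)) (S : Set (Site d)) (hS : S.Finite) :
    ∀ᶠ N : ℕ in atTop, ∀ (β h : ℝ) (g : Config d → ℂ), Loc S g →
      nuN d N β h (Pop (wC d ((β : ℂ), (h : ℂ))) l g) = nuN d N β h g := by
  induction l with
  | nil => exact Eventually.of_forall fun N β h g _ => rfl
  | cons x l ih =>
    obtain ⟨S', h1, h2⟩ := Pop_loc (R := ℂ) l S hS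
    filter_upwards [ih, redm_eventually S' h1 x, eventually_gt_atTop 0] with N hN hr h0 β h g hg
    rw [Pop_cons, ← hN β h g hg]
    haveI : NeZero (2 * N) := ⟨by omega⟩
    simp only [nuN, dif_pos h0]
    exact torus_inv N β h x h0 S' hr _ (h2 _ _ hg)

theorem nuT_den (N : ℕ) [NeZero (2 * N)] (β h : ℝ) :
    (∑ σ : (Fin d → ZMod (2 * N)) → Bool, (Real.exp (torusEnergy d N β h σ) : ℂ)) ≠ 0 := by
  have : (0 : ℝ) < ∑ σ : (Fin d → ZMod (2 * N)) → Bool, Real.exp (torusEnergy d N β h σ) :=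
    Finset.sum_pos (fun _ _ => Real.exp_pos _) Finset.univ_nonempty
  exact_mod_cast this.ne'

theorem nuN_const (N : ℕ) (hN : 0 < N) (β h : ℝ) (c : ℂ) : nuN d N β h (fun _ => c) = c := by
  haveI : NeZero (2 * N) := ⟨by omega⟩
  simp only [nuN, dif_pos hN, nuT]
  rw [← Finset.mul_sum, mul_div_assoc, div_self (nuT_den N β h), mul_one]

theorem nuN_add (N : ℕ) (β h : ℝ) (f g : Config d → ℂ) :
    nuN d N β h (fun ω => f ω + g ω) = nuN d N β h f + nuN d N β h g := by
  by_cases hN : 0 < N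
  · simp only [nuN, dif_pos hN, nuT, add_mul, Finset.sum_add_distrib, add_div]
  · simp [nuN, hN]

theorem nuN_sum {ι : Type*} (s : Finset ι) (N : ℕ) (β h : ℝ) (f : ι → Config d → ℂ) :
    nuN d N β h (fun ω => ∑ i ∈ s, f i ω) = ∑ i ∈ s, nuN d N β h (f i) := by
  by_cases hN : 0 < N
  · simp only [nuN, dif_pos hN, nuT, Finset.sum_mul]
    rw [Finset.sum_comm, Finset.sum_div]
  · simp [nuN, hN]

theorem nuN_norm_le (N : ℕ) (β h : ℝ) (f : Config d → ℂ) (a : ℝ) (hf : ∀ ω, ‖f ω‖ ≤ a) (ha : 0 ≤ a) :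
    ‖nuN d N β h f‖ ≤ a := by
  by_cases hN : 0 < N
  · haveI : NeZero (2 * N) := ⟨by omega⟩
    simp only [nuN, dif_pos hN, nuT]
    have hpos : (0 : ℝ) < ∑ σ : (Fin d → ZMod (2 * N)) → Bool, Real.exp (torusEnergy d N β h σ) :=
      Finset.sum_pos (fun _ _ => Real.exp_pos _) Finset.univ_nonempty
    rw [norm_div, ← Complex.ofReal_sum, Complex.norm_real, Real.norm_of_nonneg hpos.le,
      div_le_iff₀ hpos, Finset.mul_sum]
    refine (norm_sum_le _ _).trans (Finset.sum_le_sum fun σ _ => ?_)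
    rw [norm_mul, Complex.norm_real, Real.norm_of_nonneg (Real.exp_pos _).le]
    exact mul_le_mul_of_nonneg_right (hf _) (Real.exp_pos _).le
  · simp [nuN, hN, ha]

theorem nuN_corr (A : Finset (Site d)) (N : ℕ) (β h : ℝ) :
    (torusCorr d A β h N : ℂ) = nuN d N β h (fun ω => ∏ i ∈ A, (spin (ω i) : ℂ)) := by
  by_cases hN : 0 < N
  · simp only [nuN, dif_pos hN, nuT, torusCorr, per, redm]
    push_cast
    rfl
  · simp [nuN, hN, torusCorr]

end Torus
end IsingP

open MeasureTheory Filter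

namespace IsingP
section State
variable {d : ℕ}

def FLoc {α : Type*} (f : Config d → α) : Prop := ∃ S : Set (Site d), S.Finite ∧ Loc S f

noncomputable def ind (y : Site d) (ω : Config d) : ℝ := if ω y = true then 1 else 0
noncomputable def oneR (R : Finset (Site d)) (ω : Config d) : ℝ :=
  if ∀ z ∈ R, ω z = true then 1 else 0

structure Good (w : Th d → ℝ) (α C c : ℝ) (ν : (Config d → ℝ) → ℝ) : Prop where
  w_nonneg : ∀ u, 0 ≤ w u
  w_sum : ∑ u, w u = 1
  α_pos : 0 < α
  α_le : α ≤ w 0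
  C_nonneg : 0 ≤ C
  c_pos : 0 < c
  add : ∀ f g, FLoc f → FLoc g → ν (fun ω => f ω + g ω) = ν f + ν g
  smul : ∀ (a : ℝ) f, FLoc f → ν (fun ω => a * f ω) = a * ν f
  mono : ∀ f g, FLoc f → FLoc g → (∀ ω, f ω ≤ g ω) → ν f ≤ ν g
  one : ν (fun _ => 1) = 1
  inv : ∀ x f, FLoc f → ν (Pop w [x] f) = ν f
  wm : ∀ y (R : Finset (Site d)), 0 < ν (oneR R) →
    ν (fun ω => oneR R ω * ind y ω) ≤
      ν (oneR R) * (ν (ind y) + C * ∑ z ∈ R, Real.exp (-c * dist1 y z))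

theorem FLoc_ind (y : Site d) : FLoc (ind y) :=
  ⟨{y}, Set.finite_singleton y, fun ω ω' h => by simp [ind, h y rfl]⟩

theorem FLoc_oneR (R : Finset (Site d)) : FLoc (oneR R) :=
  ⟨R, R.finite_toSet, fun ω ω' h => by
    have : (∀ z ∈ R, ω z = true) ↔ (∀ z ∈ R, ω' z = true) :=
      forall₂_congr fun z hz => by rw [h z hz]
    simp [oneR, this]⟩

theorem FLoc.map₂ {α β γ : Type*} {f : Config d → α} {g : Config d → β} (F : α → β → γ)
    (hf : FLoc f) (hg : FLoc g) : FLoc (fun ω => F (f ω) (g ω)) := by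
  obtain ⟨S, h1, h2⟩ := hf
  obtain ⟨T, h3, h4⟩ := hg
  refine ⟨S ∪ T, h1.union h3, fun ω ω' h => ?_⟩
  show F (f ω) (g ω) = F (f ω') (g ω')
  rw [(h2.mono Set.subset_union_left) ω ω' h, (h4.mono Set.subset_union_right) ω ω' h]

theorem FLoc_const {α : Type*} (a : α) : FLoc (fun _ : Config d => a) :=
  ⟨∅, Set.finite_empty, fun _ _ _ => rfl⟩

theorem FLoc.map {α γ : Type*} {f : Config d → α} (F : α → γ)
    (hf : FLoc f) : FLoc (fun ω => F (f ω)) :=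
  FLoc.map₂ (fun a _ => F a) hf (FLoc_const ())

theorem FLoc.add {f g : Config d → ℝ} (hf : FLoc f) (hg : FLoc g) : FLoc (fun ω => f ω + g ω) :=
  hf.map₂ (fun a b => a + b) hg
theorem FLoc.mul {f g : Config d → ℝ} (hf : FLoc f) (hg : FLoc g) : FLoc (fun ω => f ω * g ω) :=
  hf.map₂ (fun a b => a * b) hg
theorem FLoc.sub {f g : Config d → ℝ} (hf : FLoc f) (hg : FLoc g) : FLoc (fun ω => f ω - g ω) :=
  hf.map₂ (fun a b => a - b) hg

theorem FLoc.sum {ι : Type*} (s : Finset ι) {f : ι → Config d → ℝ} (hf : ∀ i ∈ s, FLoc (f i)) :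
    FLoc (fun ω => ∑ i ∈ s, f i ω) := by
  classical
  induction s using Finset.induction_on with
  | empty => simpa using FLoc_const (0 : ℝ)
  | insert i s hi ih =>
    simp only [Finset.sum_insert hi]
    exact (hf i (by simp)).add (ih fun j hj => hf j (by simp [hj]))

theorem FLoc.pop {R : Type*} [CommSemiring R] {f : Config d → R} (hf : FLoc f) (w : Th d → R)
    (l : List (Site d)) : FLoc (Pop w l f) := by
  obtain ⟨S, h1, h2⟩ := hf
  obtain ⟨S', h3, h4⟩ := Pop_loc (R := R) l S h1
  exact ⟨S', h3, h4 w f h2⟩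

theorem FLoc.measurable {f : Config d → ℝ} (hf : FLoc f) : Measurable f := by
  classical
  obtain ⟨S, h1, h2⟩ := hf
  haveI := h1.fintype
  let ext : (S → Bool) → Config d := fun η x => if hx : x ∈ S then η ⟨x, hx⟩ else true
  have : f = (fun η => f (ext η)) ∘ (fun (ω : Config d) (x : S) => ω x.1) := by
    funext ω
    refine h2 _ _ fun x hx => ?_
    simp [ext, hx]
  rw [this]
  refine Measurable.comp (Measurable.of_discrete) ?_
  exact measurable_pi_lambda _ fun x => measurable_pi_apply _

theorem FLoc.bdd {f : Config d → ℝ} (hf : FLoc f) : ∃ M, ∀ ω, |f ω| ≤ M := by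
  classical
  obtain ⟨S, h1, h2⟩ := hf
  haveI := h1.fintype
  let ext : (S → Bool) → Config d := fun η x => if hx : x ∈ S then η ⟨x, hx⟩ else true
  obtain ⟨M, hM⟩ := (Set.finite_range (fun η => |f (ext η)|)).bddAbove
  refine ⟨M, fun ω => ?_⟩
  have : f ω = f (ext (fun x => ω x.1)) := by
    refine h2 _ _ fun x hx => ?_
    simp [ext, hx]
  rw [this]
  exact hM (Set.mem_range_self (f := fun η => |f (ext η)|) (fun x : S => ω x.1))

theorem FLoc.integrable {f : Config d → ℝ} (hf : FLoc f) (μ : Measure (Config d))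
    [IsProbabilityMeasure μ] : Integrable f μ := by
  obtain ⟨M, hM⟩ := hf.bdd
  exact Integrable.of_bound hf.measurable.aestronglyMeasurable M (Eventually.of_forall hM)

theorem localDensity_single (β h : ℝ) (x : Site d) (f : Config d → ℝ) (ω : Config d) :
    localDensity β h {x} f ω = Pop (wR d β h) [x] f ω := by
  classical
  letI : Unique {y // y ∈ ({x} : Finset (Site d))} :=
    ⟨⟨⟨x, Finset.mem_singleton_self x⟩⟩, fun y => Subtype.ext (Finset.mem_singleton.1 y.2)⟩
  have hp : ∀ b : Bool, patch {x} (fun _ => b) ω = Function.update ω x b := by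
    intro b; funext y
    simp only [patch]
    by_cases hy : y = x
    · subst hy; simp
    · simp [hy]
  have hsum : ∀ F : ({y // y ∈ ({x} : Finset (Site d))} → Bool) → ℝ, ∑ η, F η = F (fun _ => true) + F (fun _ => false) := by
    intro F
    rw [← Equiv.sum_comp (Equiv.funUnique {y // y ∈ ({x} : Finset (Site d))} Bool).symm]
    simp only [Fintype.sum_bool]
    rfl
  have hH : ∀ b : Bool, hamElem β h {x} (Function.update ω x b) ω = spin b * (β * (2 * cnt ω x - 2 * d) + h) := by
    intro b
    rw [← spin_sum]
    simp only [hamElem, Finset.sum_singleton, Function.update_self]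
    have e1 : nbrs x ∩ {x} = ∅ := by
      rw [Finset.inter_singleton_of_notMem (not_mem_nbrs x)]
    have e2 : nbrs x \ {x} = nbrs x := by
      rw [Finset.sdiff_singleton_eq_erase, Finset.erase_eq_of_notMem (not_mem_nbrs x)]
    rw [e1, e2, ← Finset.mul_sum]
    simp [← Finset.mul_sum]; ring
  unfold localDensity
  rw [hsum, hsum, Pop_wt]
  simp only [hp, hH]
  unfold prR
  simp only [spin, if_true, one_mul, Bool.false_eq_true, if_false, neg_one_mul]
  field_simp
  ring

def flipC (ω : Config d) : Config d := fun x => !ω x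

theorem flip_flip (ω : Config d) : flipC (flipC ω) = ω := by funext x; simp [flipC]

theorem cnt_flip (ω : Config d) (x : Site d) : cnt (flipC ω) x = 2 * d - cnt ω x := by
  rw [← nbrs_card x]
  unfold cnt
  rw [← Finset.card_filter_add_card_filter_not (s := nbrs x) (fun y => ω y = true)]
  have : (nbrs x).filter (fun y => flipC ω y = true) = (nbrs x).filter (fun y => ¬ ω y = true) :=
    Finset.filter_congr fun y _ => by simp [flipC]
  rw [this]; omega

theorem upd_flip (x : Site d) (u : Th d) (ω : Config d) :
    upd x u.rev (flipC ω) = flipC (upd x u ω) := by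
  funext y
  unfold upd
  by_cases hy : y = x
  · subst hy
    simp only [Function.update_self, flipC, cnt_flip]
    have h1 := cnt_le ω y
    have h2 := u.2
    have h3 : (u.rev : ℕ) = 2 * d + 1 - u := by rw [Fin.val_rev]; omega
    rw [h3]
    rw [← decide_not, decide_eq_decide]
    omega
  · simp [hy, flipC]

theorem Pop_flip (w : Th d → ℝ) (l : List (Site d)) (f : Config d → ℝ) (ω : Config d) :
    Pop (fun u => w u.rev) l f (flipC ω) = Pop w l (fun ω => f (flipC ω)) ω := by
  induction l generalizing ω with
  | nil => rfl
  | cons x l ih =>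
    rw [Pop_cons, Pop_cons w, Pop_single, Pop_single]
    rw [← Equiv.sum_comp Fin.revPerm]
    refine Finset.sum_congr rfl fun u _ => ?_
    simp only [Fin.revPerm_apply, Fin.rev_rev]
    rw [upd_flip, ih]

theorem FLoc.flip {α : Type*} {f : Config d → α} (hf : FLoc f) : FLoc (fun ω => f (flipC ω)) := by
  obtain ⟨S, h1, h2⟩ := hf
  exact ⟨S, h1, fun ω ω' h => h2 _ _ fun x hx => by simp [flipC, h x hx]⟩

theorem meas_one (y : Site d) (b : Bool) : MeasurableSet {ω : Config d | ω y = b} :=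
  measurableSet_eq_fun (measurable_pi_apply y) measurable_const

theorem wm_real (μ : Measure (Config d)) [IsProbabilityMeasure μ] (C c : ℝ) (hC : 0 ≤ C)
    (h : ∀ (Δ Δ' : Set (Site d)) (A B : Set (Config d)),
      MeasurableSet[cylEvents Δ] A → MeasurableSet[cylEvents Δ'] B → 0 < μ B →
      ENNReal.ofReal |(μ (A ∩ B) / μ B).toReal - (μ A).toReal| ≤
        ENNReal.ofReal C *
          ∑' (i : Δ) (j : Δ'), ENNReal.ofReal (Real.exp (-c * dist1 i.val j.val)))
    (b : Bool) (y : Site d) (R : Finset (Site d))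
    (hpos : 0 < μ.real {ω | ∀ z ∈ R, ω z = b}) :
    μ.real ({ω | ω y = b} ∩ {ω | ∀ z ∈ R, ω z = b}) ≤
      μ.real {ω | ∀ z ∈ R, ω z = b} * (μ.real {ω | ω y = b} + C * ∑ z ∈ R, Real.exp (-c * dist1 y z)) := by
  classical
  have hA : MeasurableSet[cylEvents ({y} : Set (Site d))] {ω : Config d | ω y = b} := by
    refine ⟨{η | η ⟨y, rfl⟩ = b}, ?_, rfl⟩
    exact measurableSet_eq_fun (measurable_pi_apply _) measurable_const
  have hB : MeasurableSet[cylEvents (R : Set (Site d))] {ω : Config d | ∀ z ∈ R, ω z = b} := by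
    refine ⟨{η | ∀ z, η z = b}, MeasurableSet.of_discrete, ?_⟩
    ext ω
    simp
  have hp : 0 < μ {ω : Config d | ∀ z ∈ R, ω z = b} := by
    rw [pos_iff_ne_zero]; intro h0; simp [Measure.real, h0] at hpos
  have := h {y} R _ _ hA hB hp
  have hs : ∑' (i : ({y} : Set (Site d))) (j : ((R : Set (Site d)))), ENNReal.ofReal (Real.exp (-c * dist1 i.val j.val)) = ENNReal.ofReal (∑ z ∈ R, Real.exp (-c * dist1 y z)) := by
    rw [ENNReal.ofReal_sum_of_nonneg (fun _ _ => (Real.exp_pos _).le)]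
    rw [tsum_fintype]
    simp only [Fintype.sum_unique]
    exact Finset.tsum_subtype R (fun z => ENNReal.ofReal (Real.exp (-c * dist1 y z)))
  rw [hs, ← ENNReal.ofReal_mul hC, ENNReal.ofReal_le_ofReal_iff
    (mul_nonneg hC (Finset.sum_nonneg fun _ _ => (Real.exp_pos _).le)), ENNReal.toReal_div] at this
  have h2 := (abs_le.1 this).2
  change μ.real _ / μ.real _ - μ.real _ ≤ _ at h2
  rw [sub_le_iff_le_add, div_le_iff₀ hpos] at h2
  linarith

theorem integral_ite_one (μ : Measure (Config d)) (p : Config d → Prop) [DecidablePred p]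
    (hp : MeasurableSet {ω | p ω}) : ∫ ω, (if p ω then (1 : ℝ) else 0) ∂μ = μ.real {ω | p ω} := by
  have := integral_indicator_one (μ := μ) hp
  rw [← this]
  congr 1
  funext ω
  simp [Set.indicator_apply]

theorem meas_all (R : Finset (Site d)) (b : Bool) : MeasurableSet {ω : Config d | ∀ z ∈ R, ω z = b} := by
  have : {ω : Config d | ∀ z ∈ R, ω z = b} = ⋂ z ∈ R, {ω | ω z = b} := by ext; simp
  rw [this]
  exact Finset.measurableSet_biInter R fun z _ => meas_one z b

theorem Gibbs_inv (β h : ℝ) (μ : Measure (Config d)) (hG : IsGibbs d β h μ) (x : Site d)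
    (f : Config d → ℝ) (hf : FLoc f) : ∫ ω, Pop (wR d β h) [x] f ω ∂μ = ∫ ω, f ω ∂μ := by
  rw [hG.2 {x} f hf.measurable hf.bdd]
  congr 1; funext ω; rw [localDensity_single]

theorem good_exists (β h : ℝ) (hβ : 0 ≤ β) (μ : Measure (Config d)) (hG : IsGibbs d β h μ)
    (hW : WeakMixing d μ) : ∃ α C c : ℝ, ∃ ν : (Config d → ℝ) → ℝ, Good (wR d β h) α C c ν ∧
      Good (fun u => wR d β h u.rev) α C c (fun f => ν (fun ω => f (flipC ω))) := by
  classical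
  obtain ⟨C, hC, c, hc, hwm⟩ := hW
  haveI := hG.1
  have hm := wm_real μ C c hC hwm
  have h0 : 0 < wR d β h 0 := wR_zero_pos β h
  have h1 : 0 < wR d β h (Fin.last _) := wR_last_pos β h
  have key : ∀ (p q : Config d → Prop) [DecidablePred p] [DecidablePred q], MeasurableSet {ω | p ω} → MeasurableSet {ω | q ω} →
     ∫ ω, (if p ω then (1:ℝ) else 0) * (if q ω then 1 else 0) ∂μ = μ.real ({ω | q ω} ∩ {ω | p ω}) := by
    intro p q _ _ hp hq
    have := integral_ite_one μ (fun ω => q ω ∧ p ω) (hq.inter hp)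
    rw [show ({ω | q ω} ∩ {ω | p ω}) = {ω | q ω ∧ p ω} from rfl, ← this]
    congr 1; funext ω
    by_cases h1 : p ω <;> by_cases h2 : q ω <;> simp [h1, h2]
  refine ⟨min (wR d β h 0) (wR d β h (Fin.last _)), C, c, fun f => ∫ ω, f ω ∂μ, ?_, ?_⟩
  · exact
    { w_nonneg := wR_nonneg β h hβ
      w_sum := wt_sum _
      α_pos := lt_min h0 h1
      α_le := min_le_left _ _
      C_nonneg := hC
      c_pos := hc
      add := fun f g hf hg => integral_add (hf.integrable μ) (hg.integrable μ)
      smul := fun a f hf => integral_const_mul a f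
      mono := fun f g hf hg hfg => integral_mono (hf.integrable μ) (hg.integrable μ) hfg
      one := by simp
      inv := fun x f hf => Gibbs_inv β h μ hG x f hf
      wm := by
        intro y R
        have e1 : ∫ ω, oneR R ω ∂μ = μ.real {ω | ∀ z ∈ R, ω z = true} := by
          rw [← integral_ite_one μ _ (meas_all R true)]; rfl
        have e2 : ∫ ω, ind y ω ∂μ = μ.real {ω | ω y = true} := by
          rw [← integral_ite_one μ _ (meas_one y true)]; rfl
        have e3 := key _ _ (meas_all R true) (meas_one y true)
        intro hp
        simp only [e1] at hp
        have := hm true y R hp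
        simp only [e1, e2]
        refine le_trans (le_of_eq ?_) this
        simp only [ind, oneR]
        exact e3 }
  · exact
    { w_nonneg := fun u => wR_nonneg β h hβ _
      w_sum := by rw [← wt_sum (d := d) (prR d β h)]; exact Equiv.sum_comp Fin.revPerm _
      α_pos := lt_min h0 h1
      α_le := min_le_right _ _
      C_nonneg := hC
      c_pos := hc
      add := fun f g hf hg => integral_add (hf.flip.integrable μ) (hg.flip.integrable μ)
      smul := fun a f hf => integral_const_mul a _
      mono := fun f g hf hg hfg => integral_mono (hf.flip.integrable μ) (hg.flip.integrable μ) fun ω => hfg _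
      one := by simp
      inv := fun x f hf => by
        simp only [Pop_flip]
        exact Gibbs_inv β h μ hG x _ hf.flip
      wm := by
        intro y R
        have e1 : ∫ ω, oneR R (flipC ω) ∂μ = μ.real {ω | ∀ z ∈ R, ω z = false} := by
          rw [← integral_ite_one μ _ (meas_all R false)]; simp [oneR, flipC]
        have e2 : ∫ ω, ind y (flipC ω) ∂μ = μ.real {ω | ω y = false} := by
          rw [← integral_ite_one μ _ (meas_one y false)]; simp [ind, flipC]
        have e3 := key _ _ (meas_all R false) (meas_one y false)
        intro hp
        simp only [e1] at hp
        have := hm false y R hp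
        simp only [e1, e2]
        refine le_trans (le_of_eq ?_) this
        simp only [ind, oneR, flipC, Bool.not_eq_true']
        exact e3 }

end State
end IsingP

open MeasureTheory Filter

namespace IsingP
section Stage
variable {d : ℕ}

theorem Pop_mono_fun {w : Th d → ℝ} (hw : ∀ u, 0 ≤ w u) (l : List (Site d)) {f g : Config d → ℝ}
    (h : ∀ ω, f ω ≤ g ω) (ω) : Pop w l f ω ≤ Pop w l g ω :=
  Av_mono hw l _ _ fun _ _ => h _

theorem Pop_monotone {w : Th d → ℝ} (hw : ∀ u, 0 ≤ w u) (l : List (Site d)) {f : Config d → ℝ}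
    (h : Monotone f) : Monotone (Pop w l f) := fun _ _ hω =>
  Av_mono hw l _ _ fun L _ => h (Phi_mono L hω)

theorem Pop_const {w : Th d → ℝ} (hw : ∑ u, w u = 1) (l : List (Site d)) (a : ℝ) (ω) :
    Pop w l (fun _ => a) ω = a := by
  unfold Pop
  rw [Av_const, hw]; simp

theorem Pop_add (w : Th d → ℝ) (l : List (Site d)) (f g : Config d → ℝ) (ω) :
    Pop w l (fun ω => f ω + g ω) ω = Pop w l f ω + Pop w l g ω := Av_add _ _ _ _

theorem Pop_smul (w : Th d → ℝ) (l : List (Site d)) (a : ℝ) (f : Config d → ℝ) (ω) :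
    Pop w l (fun ω => a * f ω) ω = a * Pop w l f ω := Av_mul_left _ _ _ _

theorem Pop_sub (w : Th d → ℝ) (l : List (Site d)) (f g : Config d → ℝ) (ω) :
    Pop w l (fun ω => f ω - g ω) ω = Pop w l f ω - Pop w l g ω := by
  have h := Pop_add w l f (fun ω => (-1) * g ω) ω
  rw [Pop_smul] at h
  have e : (fun ω => f ω - g ω) = (fun ω => f ω + (-1) * g ω) := by funext ω; ring
  rw [e, h]; ring

theorem Pop_sum (w : Th d → ℝ) (l : List (Site d)) {ι : Type*} (s : Finset ι)
    (f : ι → Config d → ℝ) (ω) :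
    Pop w l (fun ω => ∑ i ∈ s, f i ω) ω = ∑ i ∈ s, Pop w l (f i) ω := Av_sum _ _ _ _

theorem Pop_loc_mul (w : Th d → ℝ) (l : List (Site d)) (s : Set (Site d)) (F g : Config d → ℝ)
    (hF : Loc s F) (hs : ∀ x ∈ l, x ∉ s) (ω) :
    Pop w l (fun ω => F ω * g ω) ω = F ω * Pop w l g ω := by
  unfold Pop
  rw [← Av_mul_left]
  refine Av_congr _ _ _ _ fun L hL => ?_
  show F (Phi L ω) * g (Phi L ω) = F ω * g (Phi L ω)
  congr 1
  refine hF _ _ fun x hx => ?_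
  apply Phi_eq_off
  rw [hL]
  exact fun h => hs x h hx

theorem Pop_off {w : Th d → ℝ} (hw : ∑ u, w u = 1) (l : List (Site d)) (s : Set (Site d)) (F : Config d → ℝ)
    (hF : Loc s F) (hs : ∀ x ∈ l, x ∉ s) (ω) : Pop w l F ω = F ω := by
  have := Pop_loc_mul w l s F (fun _ => 1) hF hs ω
  rw [Pop_const hw] at this
  simpa using this

theorem Pop_filter {w : Th d → ℝ} (hw : ∑ u, w u = 1) (l : List (Site d)) (Z : Finset (Site d))
    (hl : ∀ x ∈ l, x ∈ Z → ∀ y ∈ nbrs x, y ∈ Z) (f : Config d → ℝ) (hf : Loc (Z : Set (Site d)) f)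
    (ω ω' : Config d) (h : ∀ x ∈ Z, ω x = ω' x) :
    Pop w l f ω = Pop w (l.filter (fun x => decide (x ∈ Z))) f ω' := by
  have h1 : Pop w l f ω = Av w l (fun L => (fun L' => f (Phi L' ω')) (L.filter (fun q => decide (q.1 ∈ Z))) *
      (fun _ => (1:ℝ)) (L.filter (fun q => !decide (q.1 ∈ Z)))) := by
    unfold Pop
    refine Av_congr _ _ _ _ fun L hL => ?_
    simp only [mul_one]
    refine hf _ _ fun x hx => ?_
    refine Phi_closed (fun x => decide (x ∈ Z)) L ?_ ω ω' ?_ x (by simpa using hx)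
    · rw [hL]; simpa using hl
    · simpa using h
  rw [h1]
  have h2 := Av_factor w (fun x => decide (x ∈ Z)) l (fun L' => f (Phi L' ω')) (fun _ => (1:ℝ))
  rw [h2, Av_const, hw]
  simp [Pop]

theorem Phi_zero (l : List (Site d)) (ω : Config d) (y : Site d) :
    Phi (l.map (fun x => (x, (0 : Th d)))) ω y = if y ∈ l then true else ω y := by
  induction l generalizing ω with
  | nil => simp [Phi_nil]
  | cons x l ih =>
    rw [List.map_cons, Phi_cons, ih]
    by_cases hy : y ∈ l
    · simp [hy]
    · by_cases hyx : y = x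
      · subst hyx; simp [upd]
      · simp [hy, hyx, upd]

theorem Av_zero_term {X : Type*} {w : Th d → ℝ} (hw : ∀ u, 0 ≤ w u) (l : List X) (G : List (X × Th d) → ℝ)
    (hG : ∀ L, 0 ≤ G L) : (w 0) ^ l.length * G (l.map (fun x => (x, (0 : Th d)))) ≤ Av w l G := by
  induction l generalizing G with
  | nil => simp [Av_nil]
  | cons x l ih =>
    rw [Av_cons]
    have h1 : w 0 * Av w l (fun L => G ((x, 0) :: L)) ≤ ∑ u, w u * Av w l (fun L => G ((x, u) :: L)) :=
      Finset.single_le_sum (f := fun u => w u * Av w l (fun L => G ((x, u) :: L)))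
        (fun u _ => mul_nonneg (hw u) (Av_nonneg hw _ _ fun _ _ => hG _)) (Finset.mem_univ 0)
    refine le_trans ?_ h1
    have := ih (fun L => G ((x, 0) :: L)) fun _ => hG _
    rw [List.length_cons, pow_succ', mul_assoc]
    exact mul_le_mul_of_nonneg_left this (hw 0)

theorem Av_doeblin {X : Type*} {w : Th d → ℝ} (hw : ∀ u, 0 ≤ w u) (h1 : ∑ u, w u = 1) (l : List X)
    (G : List (X × Th d) → ℝ) (K : ℝ)
    (hG : ∀ L, L.map Prod.fst = l → G L ≤ K) (h0 : G (l.map (fun x => (x, (0 : Th d)))) ≤ 0) :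
    Av w l G ≤ K * (1 - (w 0) ^ l.length) := by
  classical
  have a := Av_zero_term hw l (fun L => if L.map Prod.fst = l then K - G L else 0) (by
    intro L; split_ifs with h
    · linarith [hG L h]
    · exact le_rfl)
  have hm : List.map Prod.fst (l.map (fun x => (x, (0 : Th d)))) = l := by
    rw [List.map_map]; simp [Function.comp_def]
  rw [if_pos hm] at a
  have b : Av w l (fun L => if L.map Prod.fst = l then K - G L else 0) = K - Av w l G := by
    have h2 : Av w l (fun L => if L.map Prod.fst = l then K - G L else 0) = Av w l (fun L => K + (-1) * G L) :=
      Av_congr _ _ _ _ fun L hL => by rw [if_pos hL]; ring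
    rw [h2, Av_add, Av_const, Av_mul_left, h1]; simp; ring
  rw [b] at a
  have : 0 ≤ w 0 ^ l.length := pow_nonneg (hw 0) _
  nlinarith

theorem doeblin {w : Th d → ℝ} (hw : ∀ u, 0 ≤ w u) (h1 : ∑ u, w u = 1) {α : ℝ} (hα : 0 < α)
    (hαw : α ≤ w 0) (n : ℕ) (lV : List (Site d)) (hn : lV.length ≤ n) (M : ℕ)
    (f : Config d → ℝ) (hf : ∀ ω ω', f ω - f ω' ≤ 1) (ω ω' : Config d) (h : ∀ x, x ∉ lV → ω x = ω' x) :
    Pop w (List.replicate M lV).flatten f ω - Pop w (List.replicate M lV).flatten f ω' ≤ (1 - α ^ n) ^ M := by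
  have hw1 : w 0 ≤ 1 := by
    rw [← h1]; exact Finset.single_le_sum (fun u _ => hw u) (Finset.mem_univ 0)
  have hle : α ^ n ≤ (w 0) ^ lV.length := by
    calc α ^ n ≤ (w 0) ^ n := by gcongr
      _ ≤ _ := pow_le_pow_of_le_one (hw 0) hw1 hn
  have hle1 : α ^ n ≤ 1 := pow_le_one₀ hα.le (hαw.trans hw1)
  induction M generalizing ω ω' with
  | zero => simpa [Pop_nil] using hf ω ω'
  | succ M ih =>
    rw [List.replicate_succ, List.flatten_cons, Pop_append]
    generalize Pop w (List.replicate M lV).flatten f = F at ih ⊢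
    have e : Pop w lV F ω - Pop w lV F ω' = Av w lV (fun L => F (Phi L ω) + (-1) * F (Phi L ω')) := by
      rw [Av_add, Av_mul_left]; simp [Pop]; ring
    rw [e, pow_succ]
    have := Av_doeblin hw h1 lV (fun L => F (Phi L ω) + (-1) * F (Phi L ω')) ((1 - α ^ n) ^ M) ?_ ?_
    · refine this.trans (mul_le_mul_of_nonneg_left (by linarith) (pow_nonneg (by linarith) _))
    · intro L hL
      have := ih (Phi L ω) (Phi L ω') (fun x hx => by
        rw [Phi_eq_off _ _ (by rwa [hL]), Phi_eq_off _ _ (by rwa [hL]), h x hx])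
      linarith
    · have : Phi (lV.map (fun x => (x, (0 : Th d)))) ω = Phi (lV.map (fun x => (x, (0 : Th d)))) ω' := by
        funext y
        rw [Phi_zero, Phi_zero]
        split_ifs with hy
        · rfl
        · exact h y hy
      rw [this]; linarith

namespace Good
variable {w : Th d → ℝ} {α C c : ℝ} {ν : (Config d → ℝ) → ℝ} (hG : Good w α C c ν)
include hG

theorem inv_list (l : List (Site d)) (f : Config d → ℝ) (hf : FLoc f) : ν (Pop w l f) = ν f := by
  induction l with
  | nil => rfl
  | cons x l ih => rw [Pop_cons, hG.inv _ _ (hf.pop w l), ih]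

theorem sub (f g : Config d → ℝ) (hf : FLoc f) (hg : FLoc g) : ν (fun ω => f ω - g ω) = ν f - ν g := by
  have h := hG.add f (fun ω => (-1) * g ω) hf ((FLoc_const (-1)).mul hg)
  rw [hG.smul _ _ hg] at h
  have e : (fun ω => f ω - g ω) = (fun ω => f ω + (-1) * g ω) := by funext ω; ring
  rw [e, h]; ring

theorem const (a : ℝ) : ν (fun _ => a) = a := by
  have := hG.smul a (fun _ => 1) (FLoc_const 1)
  rw [hG.one] at this
  simpa using this

theorem sum {ι : Type*} (s : Finset ι) (f : ι → Config d → ℝ) (hf : ∀ i ∈ s, FLoc (f i)) :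
    ν (fun ω => ∑ i ∈ s, f i ω) = ∑ i ∈ s, ν (f i) := by
  classical
  induction s using Finset.induction_on with
  | empty => simpa using hG.const 0
  | insert i s hi ih =>
    simp only [Finset.sum_insert hi]
    rw [hG.add _ _ (hf i (by simp)) (FLoc.sum s fun j hj => hf j (by simp [hj])), ih fun j hj => hf j (by simp [hj])]

theorem pos_oneR (R : Finset (Site d)) : 0 < ν (oneR R) := by
  rw [← hG.inv_list R.toList _ (FLoc_oneR R)]
  have hw0 : 0 < w 0 := hG.α_pos.trans_le hG.α_le
  have : (fun _ : Config d => (w 0) ^ R.toList.length) ≤ Pop w R.toList (oneR R) := by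
    intro ω
    have := Av_zero_term hG.w_nonneg R.toList (fun L => oneR R (Phi L ω)) (fun L => by
      unfold oneR; split_ifs <;> norm_num)
    have e : oneR R (Phi (R.toList.map (fun x => (x, (0 : Th d)))) ω) = 1 := by
      unfold oneR
      rw [if_pos]
      intro z hz
      rw [Phi_zero, if_pos (by simpa using hz)]
    rw [e, mul_one] at this
    exact this
  have := hG.mono _ _ (FLoc_const _) ((FLoc_oneR R).pop w R.toList) this
  rw [hG.const] at this
  exact (pow_pos hw0 _).trans_le this

theorem le_top (l : List (Site d)) (f : Config d → ℝ) (hf : FLoc f) (hm : Monotone f) :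
    ν f ≤ Pop w l f ⊤ := by
  rw [← hG.inv_list l f hf]
  have := hG.mono _ (fun _ => Pop w l f ⊤) (hf.pop w l) (FLoc_const _)
    (fun ω => Pop_monotone hG.w_nonneg l hm (_root_.le_top))
  rwa [hG.const] at this

end Good

theorem ind_mono (y : Site d) : Monotone (ind y) := by
  intro ω ω' h
  unfold ind
  have := h y
  by_cases h1 : ω y = true
  · rw [h1] at this
    have := Bool.eq_true_of_true_le this
    simp [h1, this]
  · rw [if_neg h1]; split_ifs <;> norm_num

theorem ind_nonneg (y : Site d) (ω) : 0 ≤ ind y ω := by unfold ind; split_ifs <;> norm_num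
theorem ind_le_one (y : Site d) (ω) : ind y ω ≤ 1 := by unfold ind; split_ifs <;> norm_num

theorem Loc_ind {s : Set (Site d)} {y : Site d} (hy : y ∈ s) : Loc s (ind y) :=
  fun ω ω' h => by simp [ind, h y hy]

end Stage
end IsingP

open MeasureTheory Filter

namespace IsingP
section Stage2
variable {d : ℕ}

def ovr (K : Finset (Site d)) (ω : Config d) : Config d := fun x => if x ∈ K then ω x else true

theorem ovr_mono (K : Finset (Site d)) : Monotone (ovr K) := by
  intro ω ω' h x
  unfold ovr
  split_ifs
  · exact h x
  · exact le_rfl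

theorem le_ovr (K : Finset (Site d)) (ω : Config d) : ω ≤ ovr K ω := by
  intro x
  unfold ovr
  split_ifs
  · exact le_rfl
  · exact Bool.le_true _

theorem filter_flatten_replicate (p : Site d → Bool) (M : ℕ) (l : List (Site d)) :
    (List.replicate M l).flatten.filter p = (List.replicate M (l.filter p)).flatten := by
  rw [List.filter_flatten, List.map_replicate]

theorem nodup_filter_len (l : List (Site d)) (hl : l.Nodup) (Z : Finset (Site d)) :
    (l.filter (fun x => decide (x ∈ Z))).length ≤ Z.card := by
  rw [← List.toFinset_card_of_nodup (hl.filter _)]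
  apply Finset.card_le_card
  intro x; simp

theorem ind_diff {x : Site d} {ω ω' : Config d} (h : ω x ≤ ω' x) (hne : ω x ≠ ω' x) :
    ind x ω' - ind x ω = 1 := by
  unfold ind
  revert h hne
  cases hx1 : ω x <;> cases hx2 : ω' x <;> simp

set_option maxHeartbeats 1000000 in
theorem stage {w : Th d → ℝ} {α C c : ℝ} {ν : (Config d → ℝ) → ℝ} (hG : Good w α C c ν)
    (l1 lst : List (Site d)) (M n : ℕ) (Z K R : Finset (Site d)) (y : Site d) (hy : y ∈ Z)
    (hK : K ⊆ Z)
    (hlstR : ∀ x ∈ lst, x ∉ R)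
    (hRn : ∀ x ∈ Z, x ∉ R → ∀ v ∈ nbrs x, v ∈ Z)
    (cover : ∀ x ∈ Z, x ∈ lst ∨ x ∈ K ∨ x ∈ R)
    (hnd : lst.Nodup) (hcard : Z.card ≤ n) (e : ℝ)
    (he : C * ∑ z ∈ R, Real.exp (-c * dist1 y z) ≤ e) (ε' : ℝ)
    (hε' : ∀ z ∈ K, Pop w l1 (ind z) ⊤ - ν (ind z) ≤ ε') :
    Pop w (l1 ++ (List.replicate M lst).flatten) (ind y) ⊤ - ν (ind y) ≤
      K.card * ε' + e + 2 * (1 - α ^ n) ^ M := by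
  classical
  set η := (1 - α ^ n) ^ M with hη
  set lV := lst.filter (fun x => decide (x ∈ Z)) with hlV
  set lc := (List.replicate M lst).flatten with hlc
  set lZ := (List.replicate M lV).flatten with hlZ
  have hlcm : ∀ x ∈ lc, x ∈ lst := by
    intro x hx
    simp only [hlc, List.mem_flatten, List.mem_replicate] at hx
    obtain ⟨l, ⟨_, rfl⟩, h⟩ := hx
    exact h
  have hlZm : ∀ x ∈ lZ, x ∈ lV := by
    intro x hx
    simp only [hlZ, List.mem_flatten, List.mem_replicate] at hx
    obtain ⟨l, ⟨_, rfl⟩, h⟩ := hx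
    exact h
  have hfil : lc.filter (fun x => decide (x ∈ Z)) = lZ := filter_flatten_replicate _ _ _
  set m := Pop w lc (ind y) with hm
  have hmZ : ∀ ω ω', (∀ x ∈ Z, ω x = ω' x) → m ω = Pop w lZ (ind y) ω' := by
    intro ω ω' h
    rw [hm, ← hfil]
    exact Pop_filter hG.w_sum lc Z (fun x hx hxZ => hRn x hxZ (hlstR x (hlcm x hx))) _ (Loc_ind hy) ω ω' h
  have hmZ' : m = Pop w lZ (ind y) := funext fun ω => hmZ ω ω fun _ _ => rfl
  have hmloc : Loc (Z : Set (Site d)) m := fun ω ω' h => by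
    rw [hmZ ω ω' h, hmZ']
  have hmmono : Monotone m := Pop_monotone hG.w_nonneg lc (ind_mono y)
  have hm0 : ∀ ω, 0 ≤ m ω := fun ω => Av_nonneg hG.w_nonneg _ _ fun _ _ => ind_nonneg _ _
  have hm1 : ∀ ω, m ω ≤ 1 := fun ω => by
    have := Pop_mono_fun hG.w_nonneg lc (ind_le_one y) ω
    rwa [Pop_const hG.w_sum] at this
  have hlVn : lV.length ≤ n := (nodup_filter_len lst hnd Z).trans hcard
  have hmFL : FLoc m := ⟨Z, Z.finite_toSet, hmloc⟩
  set g : Config d → ℝ := fun ω => m (ovr K ω) with hg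
  have hgm : ∀ ω, m ω ≤ g ω := fun ω => hmmono (le_ovr K ω)
  have hgmono : Monotone g := fun ω ω' h => hmmono (ovr_mono K h)
  have hgloc : Loc (K : Set (Site d)) g := by
    intro ω ω' h
    have : ovr K ω = ovr K ω' := by
      funext x; unfold ovr; split_ifs with hx
      · exact h x hx
      · rfl
    simp only [hg, this]
  have hgFL : FLoc g := ⟨K, K.finite_toSet, hgloc⟩
  have hgZ : Loc (Z : Set (Site d)) g := hgloc.mono (by exact_mod_cast hK)
  have hg01 : ∀ ω ω', g ω - g ω' ≤ 1 := fun ω ω' => by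
    simp only [hg]; linarith [hm0 (ovr K ω'), hm1 (ovr K ω)]
  -- step 3a : g ≤ m + η on R = true
  have hgη : ∀ ω, oneR R ω * g ω ≤ oneR R ω * m ω + η * oneR R ω := by
    intro ω
    unfold oneR
    split_ifs with hR
    · simp only [one_mul, mul_one]
      set ω' : Config d := fun x => if x ∈ Z then ovr K ω x else ω x with hω'
      have e1 : g ω = m ω' := hmloc _ _ fun x hx => by
        have : x ∈ Z := hx
        simp [hω', this]
      have := doeblin hG.w_nonneg hG.w_sum hG.α_pos hG.α_le n lV hlVn M (ind y)
        (fun ω ω' => by linarith [ind_nonneg y ω', ind_le_one y ω]) ω' ω ?_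
      · rw [e1, hmZ']; linarith
      · intro x hx
        simp only [hω']
        split_ifs with hxZ
        · unfold ovr
          split_ifs with hxK
          · rfl
          · rcases cover x hxZ with h | h | h
            · exact absurd (by simp [hlV, h, hxZ]) hx
            · exact absurd h hxK
            · exact (hR x h).symm
        · rfl
    · simp
  -- step 3b
  set lB := (Z \ R).toList with hlB
  have hlBn : lB.length ≤ n := by
    rw [hlB, Finset.length_toList]
    exact (Finset.card_le_card Finset.sdiff_subset).trans hcard
  set lBM := (List.replicate M lB).flatten with hlBM
  have hlBMm : ∀ x ∈ lBM, x ∈ Z ∧ x ∉ R := by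
    intro x hx
    simp only [hlBM, List.mem_flatten, List.mem_replicate] at hx
    obtain ⟨l, ⟨_, rfl⟩, h⟩ := hx
    simpa [hlB] using h
  set hh := Pop w lBM g with hhh
  have hhFL : FLoc hh := hgFL.pop w lBM
  have hhmono : Monotone hh := Pop_monotone hG.w_nonneg lBM hgmono
  have hhloc : ∀ ω ω', (∀ x ∈ Z, ω x = ω' x) → hh ω = hh ω' := by
    intro ω ω' h
    have a1 := Pop_filter hG.w_sum lBM Z (fun x hx hxZ => hRn x hxZ (hlBMm x hx).2) g hgZ ω ω' h
    have a2 := Pop_filter hG.w_sum lBM Z (fun x hx hxZ => hRn x hxZ (hlBMm x hx).2) g hgZ ω' ω' (fun _ _ => rfl)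
    rw [hhh, a1, a2]
  have s1 : ν g ≤ hh ⊤ := hG.le_top lBM g hgFL hgmono
  have s2 : ∀ ω, oneR R ω * hh ⊤ ≤ oneR R ω * hh ω + η * oneR R ω := by
    intro ω
    unfold oneR
    split_ifs with hR
    · simp only [one_mul, mul_one]
      set ω' : Config d := fun x => if x ∈ Z then true else ω x with hω'
      have e1 : hh ⊤ = hh ω' := hhloc _ _ fun x hx => by simp [hω', hx]
      have := doeblin hG.w_nonneg hG.w_sum hG.α_pos hG.α_le n lB hlBn M g hg01 ω' ω ?_
      · rw [e1]; linarith
      · intro x hx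
        simp only [hω']
        split_ifs with hxZ
        · have : x ∈ R := by by_contra h; exact hx (by simp [hlB, hxZ, h])
          exact (hR x this).symm
        · rfl
    · simp
  have hRloc : Loc (R : Set (Site d)) (oneR R) := by
    intro ω ω' h
    have : (∀ z ∈ R, ω z = true) ↔ (∀ z ∈ R, ω' z = true) :=
      forall₂_congr fun z hz => by rw [h z hz]
    simp [oneR, this]
  have hRF := FLoc_oneR R
  have hRpos := hG.pos_oneR R
  set ρ := ν (oneR R) with hρ
  have t1 : ρ * hh ⊤ ≤ ν (fun ω => oneR R ω * hh ω) + η * ρ := by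
    have := hG.mono (fun ω => oneR R ω * hh ⊤) (fun ω => oneR R ω * hh ω + η * oneR R ω)
      (hRF.mul (FLoc_const _)) ((hRF.mul hhFL).add ((FLoc_const η).mul hRF)) s2
    rw [hG.add _ _ (hRF.mul hhFL) ((FLoc_const η).mul hRF), hG.smul _ _ hRF] at this
    have e1 : (fun ω => oneR R ω * hh ⊤) = (fun ω => hh ⊤ * oneR R ω) := by funext ω; ring
    rw [e1, hG.smul _ _ hRF] at this
    linarith
  have t2 : ν (fun ω => oneR R ω * hh ω) = ν (fun ω => oneR R ω * g ω) := by
    rw [← hG.inv_list lBM _ (hRF.mul hgFL)]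
    congr 1
    funext ω
    exact (Pop_loc_mul w lBM R (oneR R) g hRloc (fun x hx => (hlBMm x hx).2) ω).symm
  have t3 : ν (fun ω => oneR R ω * g ω) ≤ ν (fun ω => oneR R ω * m ω) + η * ρ := by
    have := hG.mono (fun ω => oneR R ω * g ω) (fun ω => oneR R ω * m ω + η * oneR R ω)
      (hRF.mul hgFL) ((hRF.mul hmFL).add ((FLoc_const η).mul hRF)) hgη
    rwa [hG.add _ _ (hRF.mul hmFL) ((FLoc_const η).mul hRF), hG.smul _ _ hRF] at this
  have t4 : ν (fun ω => oneR R ω * m ω) = ν (fun ω => oneR R ω * ind y ω) := by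
    rw [← hG.inv_list lc _ (hRF.mul (FLoc_ind y))]
    congr 1
    funext ω
    exact (Pop_loc_mul w lc R (oneR R) _ hRloc (fun x hx => hlstR x (hlcm x hx)) ω).symm
  have t5 := hG.wm y R hRpos
  have t6 : ρ * ν g ≤ ρ * (ν (ind y) + e + 2 * η) := by
    have a1 : ρ * ν g ≤ ρ * hh ⊤ := mul_le_mul_of_nonneg_left s1 hRpos.le
    have a2 : ρ * (C * ∑ z ∈ R, Real.exp (-c * dist1 y z)) ≤ ρ * e := mul_le_mul_of_nonneg_left he hRpos.le
    rw [← hρ] at t5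
    rw [t2] at t1
    rw [t4] at t3
    linarith
  have t7 : ν g ≤ ν (ind y) + e + 2 * η := le_of_mul_le_mul_left t6 hRpos
  -- step 2
  have u1 : Monotone (fun ω => ∑ z ∈ K, ind z ω - g ω) := by
    intro ω ω' hωω
    show ∑ z ∈ K, ind z ω - g ω ≤ ∑ z ∈ K, ind z ω' - g ω'
    have hterm : ∀ z ∈ K, 0 ≤ ind z ω' - ind z ω := fun z _ => sub_nonneg.2 (ind_mono z hωω)
    by_cases hall : ∀ x ∈ K, ω x = ω' x
    · have : g ω = g ω' := hgloc _ _ hall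
      have := Finset.sum_nonneg hterm
      rw [Finset.sum_sub_distrib] at this
      linarith
    · push Not at hall
      obtain ⟨x, hx, hne⟩ := hall
      have h1 : ind x ω' - ind x ω = 1 := by
        exact ind_diff (hωω x) hne
      have := Finset.single_le_sum hterm hx
      rw [Finset.sum_sub_distrib, h1] at this
      linarith [hg01 ω' ω]
  have hsF : FLoc (fun ω : Config d => ∑ z ∈ K, ind z ω) := FLoc.sum K fun z _ => FLoc_ind z
  have u2 := hG.le_top l1 _ (hsF.sub hgFL) u1
  rw [hG.sub _ _ hsF hgFL, Pop_sub, hG.sum K _ (fun z _ => FLoc_ind z), Pop_sum] at u2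
  have u3 : ∑ z ∈ K, (Pop w l1 (ind z) ⊤ - ν (ind z)) ≤ K.card * ε' := by
    rw [← nsmul_eq_mul]; exact Finset.sum_le_card_nsmul _ _ _ hε'
  rw [Finset.sum_sub_distrib] at u3
  have u4 : Pop w (l1 ++ lc) (ind y) ⊤ ≤ Pop w l1 g ⊤ := by
    rw [Pop_append]
    exact Pop_mono_fun hG.w_nonneg l1 hgm ⊤
  linarith

end Stage2
end IsingP

open MeasureTheory Filter

namespace IsingP
section Geometry
variable {d : ℕ}

def wall (o P : ℤ) (x : Site d) : Prop := ∃ k, P ∣ x k - o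

def far (ℓ o P : ℤ) (x : Site d) : Prop := ∀ k, ∀ t : ℤ, ℓ < |x k - o - P * t|

noncomputable def box (o : ℤ) (P : ℕ) (y : Site d) : Finset (Site d) :=
  Finset.Icc (fun k => o + P * ((y k - o) / P)) (fun k => o + P * ((y k - o) / P) + P)

theorem mem_box {o : ℤ} {P : ℕ} {y z : Site d} : z ∈ box o P y ↔
    ∀ k, o + P * ((y k - o) / P) ≤ z k ∧ z k ≤ o + P * ((y k - o) / P) + P := by
  unfold box
  rw [Finset.mem_Icc, Pi.le_def, Pi.le_def, ← forall_and]

theorem div_bounds {P : ℕ} (hP : 0 < P) (a : ℤ) : P * (a / P) ≤ a ∧ a < P * (a / P) + P := by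
  have hP' : (0 : ℤ) < P := by exact_mod_cast hP
  have h1 := Int.emod_add_mul_ediv a P
  have h2 := Int.emod_nonneg a hP'.ne'
  have h3 := Int.emod_lt_of_pos a hP'
  constructor <;> linarith

theorem self_mem_box (o : ℤ) {P : ℕ} (hP : 0 < P) (y : Site d) : y ∈ box o P y := by
  rw [mem_box]
  intro k
  have := div_bounds hP (y k - o)
  constructor <;> linarith

theorem box_dist {o : ℤ} {P : ℕ} (hP : 0 < P) {y z : Site d} (hz : z ∈ box o P y) (k : Fin d) :
    |z k - y k| ≤ P := by
  have h1 := mem_box.1 hz k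
  have := div_bounds hP (y k - o)
  rw [abs_le]
  constructor <;> linarith

theorem box_card (o : ℤ) (P : ℕ) (y : Site d) : (box o P y).card = (P + 1) ^ d := by
  unfold box
  rw [Pi.card_Icc]
  simp only [Int.card_Icc]
  rw [Finset.prod_congr rfl (g := fun _ => P + 1)]
  · simp
  · intro k _
    have : o + (P:ℤ) * ((y k - o) / P) + P + 1 - (o + P * ((y k - o) / P)) = ((P + 1 : ℕ) : ℤ) := by
      push_cast; ring
    rw [this, Int.toNat_natCast]

theorem box_nbrs {o : ℤ} {P : ℕ} {y z : Site d} (hz : z ∈ box o P y)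
    (hw : ¬ wall o P z) : ∀ v ∈ nbrs z, v ∈ box o P y := by
  intro v hv
  simp only [nbrs, Finset.mem_image, Finset.mem_univ, true_and] at hv
  obtain ⟨⟨k, b⟩, rfl⟩ := hv
  rw [mem_box] at hz ⊢
  intro j
  have hj := hz j
  by_cases hjk : j = k
  · subst hjk
    have n1 : z j ≠ o + P * ((y j - o) / P) := fun h => hw ⟨j, ⟨(y j - o) / P, by rw [h]; ring⟩⟩
    have n2 : z j ≠ o + P * ((y j - o) / P) + P := fun h => hw ⟨j, ⟨(y j - o) / P + 1, by rw [h]; ring⟩⟩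
    have h1 := lt_of_le_of_ne hj.1 n1.symm
    have h2 := lt_of_le_of_ne hj.2 n2
    simp only [if_true]
    cases b <;> simp <;> constructor <;> omega
  · simpa [hjk] using hj

theorem far_dist {ℓ o P : ℤ} {y z : Site d} (hy : far ℓ o P y) (hz : wall o P z) : (ℓ : ℝ) ≤ dist1 y z := by
  obtain ⟨k, t, ht⟩ := hz
  have h1 := hy k t
  unfold dist1
  have h2 : |y k - z k| ≤ ∑ k, |y k - z k| :=
    Finset.single_le_sum (f := fun k => |y k - z k|) (fun _ _ => abs_nonneg _) (Finset.mem_univ k)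
  have h3 : y k - o - P * t = y k - z k := by rw [← ht]; ring
  rw [h3] at h1
  exact_mod_cast (h1.le.trans h2)

theorem exists_far (ℓ : ℕ) (x : Site d) :
    ∃ c < d + 1, far ℓ ((c : ℕ) * (2 * ℓ + 1) : ℤ) (((d + 1) * (2 * ℓ + 1) : ℕ) : ℤ) x := by
  by_contra hcon
  push Not at hcon
  have h : ∀ c : Fin (d + 1), ∃ k : Fin d, ∃ t : ℤ,
      |x k - ((c : ℕ) * (2 * ℓ + 1) : ℤ) - (((d + 1) * (2 * ℓ + 1) : ℕ) : ℤ) * t| ≤ ℓ := by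
    intro c
    have := hcon c c.2
    unfold far at this
    push Not at this
    exact this
  choose f t ht using h
  obtain ⟨a, b, hab, hf⟩ := Fintype.exists_ne_map_eq_of_card_lt f (by simp)
  have ha := ht a
  have hb := ht b
  rw [← hf] at hb
  rw [abs_le] at ha hb
  set X := x (f a)
  set u : ℤ := ((a : ℕ) : ℤ) + (d + 1) * t a with hu
  set v : ℤ := ((b : ℕ) : ℤ) + (d + 1) * t b with hv
  have e1 : X - ((a : ℕ) * (2 * ℓ + 1) : ℤ) - (((d + 1) * (2 * ℓ + 1) : ℕ) : ℤ) * t a = X - u * (2 * ℓ + 1) := by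
    rw [hu]; push_cast; ring
  have e2 : X - ((b : ℕ) * (2 * ℓ + 1) : ℤ) - (((d + 1) * (2 * ℓ + 1) : ℕ) : ℤ) * t b = X - v * (2 * ℓ + 1) := by
    rw [hv]; push_cast; ring
  rw [e1] at ha
  rw [e2] at hb
  have huv : u = v := by
    have p : (0:ℤ) ≤ ℓ := by positivity
    rcases lt_trichotomy u v with h | h | h
    · nlinarith
    · exact h
    · nlinarith
  have ha2 := a.2
  have hb2 := b.2
  have hm : ((a : ℕ) : ℤ) % (d + 1) = ((b : ℕ) : ℤ) % (d + 1) := by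
    have : ((a : ℕ) : ℤ) = (b : ℕ) + (d + 1) * (t b - t a) := by rw [hu, hv] at huv; linarith
    rw [this, Int.add_mul_emod_self_left]
  rw [Int.emod_eq_of_lt (by positivity) (by exact_mod_cast ha2),
    Int.emod_eq_of_lt (by positivity) (by exact_mod_cast hb2)] at hm
  exact hab (Fin.ext (by exact_mod_cast hm))

def sweepL (ls : ℕ → List (Site d)) : ℕ → List (Site d)
  | 0 => []
  | k + 1 => sweepL ls k ++ ls k

theorem sweep_loc (ls : ℕ → List (Site d)) (o : ℕ → ℤ) {P : ℕ} (hP : 0 < P)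
    (hls : ∀ c, ∀ x ∈ ls c, ¬ wall (o c) P x) (Y : Site d → Bool) (k : ℕ) :
    ∀ (L : List (Site d × Th d)) (ω ω' : Config d), L.map Prod.fst = sweepL ls k →
      (∀ x, Y x = true → ω x = ω' x) → ∀ x : Site d, (∀ z : Site d, (∀ j, |z j - x j| ≤ k * P) → Y z = true) →
      Phi L ω x = Phi (L.filter (fun q => Y q.1)) ω' x := by
  induction k with
  | zero =>
    intro L ω ω' hL h x hx
    have : L = [] := by simpa [sweepL] using hL
    subst this
    exact h x (hx x (by simp))
  | succ k ih =>
    intro L ω ω' hL h x hx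
    rw [sweepL] at hL
    obtain ⟨L1, L2, rfl, h1, h2⟩ := List.map_eq_append_iff.1 hL
    rw [Phi_append, List.filter_append, Phi_append]
    have hZY : ∀ z ∈ box (o k) P x, Y z = true := fun z hz => hx z fun j => by
      have := box_dist hP hz j
      push_cast
      have : (0:ℤ) ≤ k * P := by positivity
      linarith
    have hag : ∀ z ∈ box (o k) P x, Phi L1 ω z = Phi (L1.filter (fun q => Y q.1)) ω' z := by
      intro z hz
      refine ih L1 ω ω' h1 h z fun v hv => hx v fun j => ?_
      have a1 := box_dist hP hz j
      have a2 := hv j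
      have a3 := abs_sub_le (v j) (z j) (x j)
      push_cast
      linarith
    have hcl : ∀ z ∈ L2.map Prod.fst, decide (z ∈ box (o k) P x) = true → ∀ y ∈ nbrs z,
        decide (y ∈ box (o k) P x) = true := by
      intro z hz hzb y hy
      rw [h2] at hz
      simp only [decide_eq_true_eq] at hzb ⊢
      exact box_nbrs hzb (hls k z hz) y hy
    have b1 := Phi_closed (fun z => decide (z ∈ box (o k) P x)) L2 hcl (Phi L1 ω)
      (Phi (L1.filter (fun q => Y q.1)) ω') (fun z hz => hag z (by simpa using hz)) x
      (by simpa using self_mem_box (o k) hP x)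
    have b2 := Phi_closed (fun z => decide (z ∈ box (o k) P x)) (L2.filter (fun q => Y q.1))
      (fun z hz => hcl z (by
        obtain ⟨q, hq, rfl⟩ := List.mem_map.1 hz
        exact List.mem_map_of_mem (List.mem_of_mem_filter hq)))
      (Phi (L1.filter (fun q => Y q.1)) ω')
      (Phi (L1.filter (fun q => Y q.1)) ω') (fun z hz => rfl) x
      (by simpa using self_mem_box (o k) hP x)
    rw [b1, b2, List.filter_filter]
    congr 1
    apply List.filter_congr
    intro q _
    by_cases hq : q.1 ∈ box (o k) P x
    · simp [hq, hZY _ hq]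
    · simp [hq]

def doneS (ℓ wd P : ℤ) (c : ℕ) (x : Site d) : Prop := ∃ c' < c, far ℓ (c' * wd) P x

open Classical in
noncomputable def lstS (ℓ wd P : ℤ) (W : Finset (Site d)) (c : ℕ) : List (Site d) :=
  W.toList.filter (fun x => ¬ wall (c * wd) P x ∧ ¬ doneS ℓ wd P c x)

theorem mem_lstS {ℓ wd P : ℤ} {W : Finset (Site d)} {c : ℕ} {x : Site d} :
    x ∈ lstS ℓ wd P W c ↔ x ∈ W ∧ ¬ wall (c * wd) P x ∧ ¬ doneS ℓ wd P c x := by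
  simp [lstS]

noncomputable def lsM (ℓ wd P : ℤ) (M : ℕ) (W : Finset (Site d)) (c : ℕ) : List (Site d) :=
  (List.replicate M (lstS ℓ wd P W c)).flatten

theorem mem_lsM {ℓ wd P : ℤ} {M : ℕ} {W : Finset (Site d)} {c : ℕ} {x : Site d} (h : x ∈ lsM ℓ wd P M W c) :
    x ∈ lstS ℓ wd P W c := by
  simp only [lsM, List.mem_flatten, List.mem_replicate] at h
  obtain ⟨l, ⟨_, rfl⟩, h⟩ := h
  exact h

theorem sweep_done {w : Th d → ℝ} (hw : ∑ u, w u = 1) (ℓ wd P : ℤ) (M : ℕ) (W : Finset (Site d)) (c : ℕ) (z : Site d)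
    (hz : far ℓ (c * wd) P z) (k : ℕ) :
    Pop w (sweepL (lsM ℓ wd P M W) (c + 1 + k)) (ind z) = Pop w (sweepL (lsM ℓ wd P M W) (c + 1)) (ind z) := by
  induction k with
  | zero => rfl
  | succ k ih =>
    rw [← ih, ← add_assoc, sweepL, Pop_append]
    congr 1
    funext ω
    refine Pop_off hw _ {z} _ (Loc_ind rfl) (fun x hx hxz => ?_) ω
    have := (mem_lstS.1 (mem_lsM hx)).2.2
    rw [Set.mem_singleton_iff] at hxz
    subst hxz
    exact this ⟨c, by omega, hz⟩

theorem sweep_claim {w : Th d → ℝ} {α C κ : ℝ} {ν : (Config d → ℝ) → ℝ} (hG : Good w α C κ ν)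
    (ℓ : ℕ) (wd : ℤ) {P : ℕ} (hP : 0 < P) (M : ℕ) (W : Finset (Site d)) (n : ℕ) (hn : n = (P + 1) ^ d)
    (hα1 : α ≤ 1) (ε : ℝ)
    (hε : ε = C * (n * Real.exp (-κ * ℓ)) + 2 * (1 - α ^ n) ^ M) (c : ℕ) :
    ∀ y : Site d, far ℓ (c * wd) P y → ¬ doneS ℓ wd P c y →
      (∀ z : Site d, (∀ k, |z k - y k| ≤ (c + 1) * P) → z ∈ W) →
      Pop w (sweepL (lsM ℓ wd P M W) (c + 1)) (ind y) ⊤ - ν (ind y) ≤ ε * (n + 1) ^ (c + 1) := by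
  classical
  induction c using Nat.strong_induction_on with
  | _ c ih =>
  intro y hfar hnd hW
  have hε0 : 0 ≤ ε := by
    rw [hε]
    have : 0 ≤ 1 - α ^ n := sub_nonneg.2 (pow_le_one₀ hG.α_pos.le hα1)
    have := hG.C_nonneg
    positivity
  have hPnn : (0:ℤ) ≤ P := by positivity
  have hbW : ∀ x ∈ box (c * wd) P y, x ∈ W := fun x hx => hW x fun k => by
    have := box_dist hP hx k
    have : (0:ℤ) ≤ c * P := by positivity
    linarith
  have key := stage hG (sweepL (lsM ℓ wd P M W) c) (lstS ℓ wd P W c) M n (box (c * wd) P y)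
    ((box (c * wd) P y).filter (fun x => doneS ℓ wd P c x)) ((box (c * wd) P y).filter (fun x => wall (c * wd) P x))
    y (self_mem_box _ hP y) (Finset.filter_subset _ _)
    (fun x hx hxR => (mem_lstS.1 hx).2.1 (Finset.mem_filter.1 hxR).2)
    (fun x hx hxR => box_nbrs hx fun hwall => hxR (Finset.mem_filter.2 ⟨hx, hwall⟩))
    (fun x hx => by
      by_cases h1 : wall (c * wd) P x
      · exact Or.inr (Or.inr (Finset.mem_filter.2 ⟨hx, h1⟩))
      · by_cases h2 : doneS ℓ wd P c x
        · exact Or.inr (Or.inl (Finset.mem_filter.2 ⟨hx, h2⟩))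
        · exact Or.inl (mem_lstS.2 ⟨hbW x hx, h1, h2⟩))
    (by unfold lstS; exact (Finset.nodup_toList _).filter _)
    (by rw [box_card, hn])
    (C * (n * Real.exp (-κ * ℓ)))
    (by
      refine mul_le_mul_of_nonneg_left ?_ hG.C_nonneg
      calc _ ≤ ∑ z ∈ (box (c * wd) P y).filter (fun x => wall (c * wd) P x), Real.exp (-κ * ℓ) := by
            refine Finset.sum_le_sum fun z hz => Real.exp_le_exp.2 ?_
            have := far_dist hfar (Finset.mem_filter.1 hz).2
            have := mul_le_mul_of_nonneg_left this hG.c_pos.le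
            push_cast at this
            linarith
        _ ≤ n * Real.exp (-κ * ℓ) := by
            rw [Finset.sum_const, nsmul_eq_mul]
            refine mul_le_mul_of_nonneg_right ?_ (Real.exp_pos _).le
            have := (Finset.card_filter_le (box (c * wd) P y) (fun x => wall (c * wd) P x))
            rw [box_card, ← hn] at this
            exact_mod_cast this)
    (ε * (n + 1) ^ c)
    (by
      intro z hz
      obtain ⟨hz1, hz2⟩ := Finset.mem_filter.1 hz
      have hz2' : ∃ c', c' < c ∧ far ℓ (c' * wd) P z := by
        obtain ⟨c', h, h'⟩ := hz2; exact ⟨c', h, h'⟩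
      set c' := Nat.find hz2' with hc'
      obtain ⟨g1, g2⟩ := Nat.find_spec hz2'
      have g3 : ¬ doneS ℓ wd P c' z := by
        rintro ⟨c'', h1, h2⟩
        exact Nat.find_min hz2' h1 ⟨h1.trans g1, h2⟩
      have g4 := ih c' g1 z g2 g3 (fun v hv => hW v fun k => by
        have a1 := box_dist hP hz1 k
        have a2 := hv k
        have a3 := abs_sub_le (v k) (z k) (y k)
        have a4 : ((c' : ℤ) + 1) * P ≤ c * P := mul_le_mul_of_nonneg_right (by exact_mod_cast g1) hPnn
        linarith)
      obtain ⟨j, hj⟩ := Nat.exists_eq_add_of_le (Nat.succ_le_of_lt g1)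
      have e1 : sweepL (lsM ℓ wd P M W) c = sweepL (lsM ℓ wd P M W) (c' + 1 + j) := by
        conv_lhs => rw [hj]
      rw [e1, sweep_done hG.w_sum _ _ _ _ _ _ _ g2]
      refine g4.trans (mul_le_mul_of_nonneg_left ?_ hε0)
      refine pow_le_pow_right₀ ?_ g1
      have : (0:ℝ) ≤ n := by positivity
      linarith)
  rw [sweepL]
  refine key.trans ?_
  have hc1 : (((box (c * wd) P y).filter (fun x => doneS ℓ wd P c x)).card : ℝ) ≤ n := by
    have := (Finset.card_filter_le (box (c * wd) P y) (fun x => doneS ℓ wd P c x))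
    rw [box_card, ← hn] at this
    exact_mod_cast this
  have hX : (1:ℝ) ≤ (n + 1) ^ c := one_le_pow₀ (by have : (0:ℝ) ≤ n := by positivity
                                                   linarith)
  have a1 := mul_le_mul_of_nonneg_right hc1 (show 0 ≤ ε * ((n:ℝ) + 1) ^ c by positivity)
  have a2 := mul_le_mul_of_nonneg_left hX hε0
  rw [pow_succ]
  nlinarith

theorem flip_ind (y : Site d) (ω : Config d) : ind y (flipC ω) = 1 - ind y ω := by
  unfold ind flipC
  cases ω y <;> simp

theorem sweep_top_bot {w : Th d → ℝ} {α C κ : ℝ} {ν : (Config d → ℝ) → ℝ} (hG : Good w α C κ ν)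
    (hG' : Good (fun u => w u.rev) α C κ (fun f => ν (fun ω => f (flipC ω))))
    (ℓ : ℕ) {P : ℕ} (hP : P = (d + 1) * (2 * ℓ + 1)) (M : ℕ) (W : Finset (Site d)) (n : ℕ) (hn : n = (P + 1) ^ d)
    (ε : ℝ)
    (hε : ε = C * (n * Real.exp (-κ * ℓ)) + 2 * (1 - α ^ n) ^ M)
    (y : Site d) (hW : ∀ z : Site d, (∀ k, |z k - y k| ≤ (d + 1) * P) → z ∈ W) :
    Pop w (sweepL (lsM ℓ (2 * ℓ + 1) P M W) (d + 1)) (ind y) ⊤ -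
    Pop w (sweepL (lsM ℓ (2 * ℓ + 1) P M W) (d + 1)) (ind y) ⊥ ≤ 2 * (ε * (n + 1) ^ (d + 1)) := by
  have hP0 : 0 < P := by rw [hP]; positivity
  have hα1 : α ≤ 1 := by
    refine hG.α_le.trans ?_
    rw [← hG.w_sum]; exact Finset.single_le_sum (fun u _ => hG.w_nonneg u) (Finset.mem_univ 0)
  have hε0 : 0 ≤ ε := by
    rw [hε]
    have : 0 ≤ 1 - α ^ n := sub_nonneg.2 (pow_le_one₀ hG.α_pos.le hα1)
    have := hG.C_nonneg
    positivity
  have hPnn : (0:ℤ) ≤ P := by positivity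
  have hex : ∃ c, c < d + 1 ∧ far ℓ (c * (2 * ℓ + 1)) P y := by
    obtain ⟨c, h1, h2⟩ := exists_far ℓ y
    rw [hP]
    exact ⟨c, h1, h2⟩
  classical
  obtain ⟨g1, g2⟩ := Nat.find_spec hex
  have g3 : ¬ doneS ℓ (2 * ℓ + 1) P (Nat.find hex) y := by
    rintro ⟨c'', h1, h2⟩
    exact Nat.find_min hex h1 ⟨h1.trans g1, h2⟩
  generalize Nat.find hex = c at g1 g2 g3
  have hW' : ∀ z : Site d, (∀ k, |z k - y k| ≤ (c + 1) * P) → z ∈ W := fun z hz => hW z fun k =>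
    (hz k).trans (mul_le_mul_of_nonneg_right (by exact_mod_cast g1) hPnn)
  have a1 := sweep_claim hG ℓ (2 * ℓ + 1) hP0 M W n hn hα1 ε hε c y g2 g3 hW'
  have a2 := sweep_claim hG' ℓ (2 * ℓ + 1) hP0 M W n hn hα1 ε hε c y g2 g3 hW'
  obtain ⟨j, hj⟩ := Nat.exists_eq_add_of_le (Nat.succ_le_of_lt g1)
  rw [show d + 1 = c + 1 + j from hj]
  rw [sweep_done hG.w_sum _ _ _ _ _ _ _ g2]
  have hb : (⊤ : Config d) = flipC ⊥ := by funext x; rfl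
  nth_rewrite 1 [hb] at a2
  rw [Pop_flip] at a2
  simp only [flip_ind] at a2
  rw [Pop_sub, Pop_const hG.w_sum, hG.sub _ _ (FLoc_const _) (FLoc_ind y), hG.const] at a2
  have a3 : ε * ((n:ℝ) + 1) ^ (c + 1) ≤ ε * (n + 1) ^ (c + 1 + j) := by
    refine mul_le_mul_of_nonneg_left ?_ hε0
    refine pow_le_pow_right₀ ?_ (by omega)
    have : (0:ℝ) ≤ n := by positivity
    linarith
  linarith

end Geometry
end IsingP

open MeasureTheory Filter

namespace IsingP
section Cells
variable {d : ℕ}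

def cellOf (D : ℕ) (x : Site d) : Site d := fun k => x k / D

noncomputable def YF (D : ℕ) (q : Site d) : Finset (Site d) :=
  Finset.Icc (fun k => D * (q k - 1)) (fun k => D * (q k + 2) - 1)

theorem mem_YF {D : ℕ} (hD : 0 < D) {q x : Site d} : x ∈ YF D q ↔ ∀ k, |cellOf D x k - q k| ≤ 1 := by
  unfold YF cellOf
  rw [Finset.mem_Icc, Pi.le_def, Pi.le_def, ← forall_and]
  refine forall_congr' fun k => ?_
  have hD' : (0:ℤ) < D := by exact_mod_cast hD
  rw [abs_le]
  have h1 : q k - 1 ≤ x k / D ↔ D * (q k - 1) ≤ x k := by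
    rw [Int.le_ediv_iff_mul_le hD', mul_comm]
  have h2 : x k / D < q k + 2 ↔ x k < D * (q k + 2) := by
    rw [Int.ediv_lt_iff_lt_mul hD', mul_comm]
  constructor
  · rintro ⟨a, b⟩
    have := h1.2 a
    have := h2.2 (by omega)
    omega
  · rintro ⟨a, b⟩
    have := h1.1 (by omega)
    have := h2.1 (by omega)
    omega

theorem YF_card (D : ℕ) (q : Site d) : (YF D q).card = (3 * D) ^ d := by
  unfold YF
  rw [Pi.card_Icc]
  simp only [Int.card_Icc]
  rw [Finset.prod_congr rfl (g := fun _ => 3 * D)]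
  · simp
  · intro k _
    have : (D:ℤ) * (q k + 2) - 1 + 1 - (D * (q k - 1)) = ((3 * D : ℕ) : ℤ) := by
      push_cast; ring
    rw [this, Int.toNat_natCast]

noncomputable def cellF (D : ℕ) (q : Site d) : Finset (Site d) :=
  Finset.Icc (fun k => D * q k) (fun k => D * (q k + 1) - 1)

theorem mem_cellF {D : ℕ} (hD : 0 < D) {q x : Site d} : x ∈ cellF D q ↔ cellOf D x = q := by
  unfold cellF cellOf
  rw [Finset.mem_Icc, Pi.le_def, Pi.le_def, ← forall_and, funext_iff]
  refine forall_congr' fun k => ?_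
  have hD' : (0:ℤ) < D := by exact_mod_cast hD
  have h1 : q k ≤ x k / D ↔ D * q k ≤ x k := by
    rw [Int.le_ediv_iff_mul_le hD', mul_comm]
  have h2 : x k / D < q k + 1 ↔ x k < D * (q k + 1) := by
    rw [Int.ediv_lt_iff_lt_mul hD', mul_comm]
  constructor
  · rintro ⟨a, b⟩
    have := h1.2 a
    have := h2.2 (by omega)
    omega
  · intro a
    have := h1.1 (by omega)
    have := h2.1 (by omega)
    omega

theorem cellF_card (D : ℕ) (q : Site d) : (cellF D q).card = D ^ d := by
  unfold cellF
  rw [Pi.card_Icc]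
  simp only [Int.card_Icc]
  rw [Finset.prod_congr rfl (g := fun _ => D)]
  · simp
  · intro k _
    have : (D:ℤ) * (q k + 1) - 1 + 1 - (D * q k) = (D : ℤ) := by ring
    rw [this, Int.toNat_natCast]

theorem near_YF {D : ℕ} (hD : 0 < D) {q x z : Site d} (hx : cellOf D x = q) (hz : ∀ k, |z k - x k| ≤ D) :
    z ∈ YF D q := by
  rw [mem_YF hD]
  intro k
  have hD' : (0:ℤ) < D := by exact_mod_cast hD
  rw [← hx]
  unfold cellOf
  have := hz k
  rw [abs_le] at this ⊢
  have h1 : x k / D - 1 ≤ z k / D := by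
    rw [Int.le_ediv_iff_mul_le hD']
    have := Int.ediv_mul_le (x k) hD'.ne'
    linarith
  have h2 : z k / D ≤ x k / D + 1 := by
    have : z k ≤ x k + D * 1 := by linarith
    have := Int.ediv_le_ediv hD' this
    rwa [Int.add_mul_ediv_left _ _ hD'.ne'] at this
  constructor <;> linarith

def Bad (D : ℕ) (q : Site d) (L : List (Site d × Th d)) : Prop :=
  ∃ ω ω' : Config d, ∃ x, cellOf D x = q ∧ Phi L ω x ≠ Phi L ω' x

open Classical in
noncomputable def badI (D : ℕ) (q : Site d) (L : List (Site d × Th d)) : ℝ := if Bad D q L then 1 else 0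

theorem badI_le (D : ℕ) (hD : 0 < D) (q : Site d) (L : List (Site d × Th d)) :
    badI D q L ≤ ∑ x ∈ cellF D q, (ind x (Phi L ⊤) - ind x (Phi L ⊥)) := by
  have hterm : ∀ x ∈ cellF D q, 0 ≤ ind x (Phi L ⊤) - ind x (Phi L ⊥) :=
    fun x _ => sub_nonneg.2 (ind_mono x (Phi_mono L bot_le))
  unfold badI
  split_ifs with h
  · obtain ⟨ω, ω', x, hx, hne⟩ := h
    have hx' := (mem_cellF hD).2 hx
    refine le_trans ?_ (Finset.single_le_sum hterm hx')
    rw [ind_diff (Phi_mono L bot_le x)]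
    intro h
    have a1 := Phi_mono L (show ⊥ ≤ ω from bot_le) x
    have a2 := Phi_mono L (show ω ≤ ⊤ from le_top) x
    have b1 := Phi_mono L (show ⊥ ≤ ω' from bot_le) x
    have b2 := Phi_mono L (show ω' ≤ ⊤ from le_top) x
    rw [← h] at a2 b2
    exact hne ((le_antisymm a2 a1).trans (le_antisymm b2 b1).symm)
  · exact Finset.sum_nonneg hterm

theorem sweepL_filter_len (ls : ℕ → List (Site d)) (p : Site d → Bool) (m k : ℕ)
    (h : ∀ c, ((ls c).filter p).length ≤ m) : ((sweepL ls k).filter p).length ≤ k * m := by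
  induction k with
  | zero => simp [sweepL]
  | succ k ih =>
    rw [sweepL, List.filter_append, List.length_append, Nat.succ_mul]
    exact Nat.add_le_add ih (h k)

theorem lsM_filter_len (ℓ wd P : ℤ) (M : ℕ) (W : Finset (Site d)) (c : ℕ) (Z : Finset (Site d)) :
    ((lsM ℓ wd P M W c).filter (fun x => decide (x ∈ Z))).length ≤ M * Z.card := by
  rw [lsM, filter_flatten_replicate]
  simp only [List.length_flatten, List.map_replicate, List.sum_replicate, smul_eq_mul]
  exact Nat.mul_le_mul_left _ (nodup_filter_len _ (by unfold lstS; exact (Finset.nodup_toList _).filter _) Z)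

theorem choose_scale (C κ : ℝ) (hκ : 0 < κ) (d : ℕ) (b : ℝ) (hb : 0 < b) :
    ∃ ℓ : ℕ, (((d+1) * ((d+1) * (2 * ℓ + 1)) : ℕ) : ℝ) ^ d * (2 * ((C * ((((((d+1) * (2 * ℓ + 1)) + 1) ^ d : ℕ) : ℝ) * Real.exp (-κ * ℓ))) *
      ((((((d+1) * (2 * ℓ + 1)) + 1) ^ d : ℕ) : ℝ) + 1) ^ (d + 1))) < b := by
  let PX : Polynomial ℝ := Polynomial.C ((d:ℝ) + 1) * (Polynomial.C 2 * (Polynomial.C κ⁻¹ * Polynomial.X) + 1)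
  let NX : Polynomial ℝ := (PX + 1) ^ d
  let QX : Polynomial ℝ := (Polynomial.C ((d:ℝ) + 1) * PX) ^ d * (Polynomial.C 2 * ((Polynomial.C C * NX) * (NX + 1) ^ (d + 1)))
  have h1 := Polynomial.tendsto_div_exp_atTop QX
  have h2 : Tendsto (fun ℓ : ℕ => κ * (ℓ : ℝ)) atTop atTop :=
    Tendsto.const_mul_atTop hκ tendsto_natCast_atTop_atTop
  have h3 := h1.comp h2
  obtain ⟨ℓ, hℓ⟩ := (h3.eventually (gt_mem_nhds hb)).exists
  refine ⟨ℓ, lt_of_eq_of_lt ?_ hℓ⟩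
  simp only [Function.comp, QX, NX, PX]
  simp only [Polynomial.eval_mul, Polynomial.eval_pow, Polynomial.eval_add, Polynomial.eval_C, Polynomial.eval_X,
    Polynomial.eval_one]
  rw [inv_mul_cancel_left₀ hκ.ne', neg_mul, Real.exp_neg]
  push_cast
  field_simp

theorem sweep_exists {w : Th d → ℝ} {α C κ : ℝ} {ν : (Config d → ℝ) → ℝ} (hG : Good w α C κ ν)
    (hG' : Good (fun u => w u.rev) α C κ (fun f => ν (fun ω => f (flipC ω)))) (b : ℝ) (hb : 0 < b) :
    ∃ D : ℕ, 0 < D ∧ ∃ n : ℕ, ∃ l : Finset (Site d) → List (Site d), ∀ S,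
      (l S).length ≤ n * S.card ∧ ∀ q ∈ S,
        (∀ (L : List (Site d × Th d)) (ω ω' : Config d), L.map Prod.fst = l S → (∀ x ∈ YF D q, ω x = ω' x) →
          ∀ x, cellOf D x = q → Phi L ω x = Phi (L.filter (fun r => decide (r.1 ∈ YF D q))) ω' x) ∧
        ((l S).filter (fun x => decide (x ∈ YF D q))).length ≤ n ∧
        Av w ((l S).filter (fun x => decide (x ∈ YF D q))) (badI D q) ≤ b := by
  classical
  have hα1 : α ≤ 1 := by
    refine hG.α_le.trans ?_
    rw [← hG.w_sum]; exact Finset.single_le_sum (fun u _ => hG.w_nonneg u) (Finset.mem_univ 0)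
  obtain ⟨ℓ, hℓ⟩ := choose_scale C κ hG.c_pos d b hb
  obtain ⟨P, hP⟩ : ∃ P, P = (d + 1) * (2 * ℓ + 1) := ⟨_, rfl⟩
  obtain ⟨n, hn⟩ : ∃ n, n = (P + 1) ^ d := ⟨_, rfl⟩
  rw [← hP, ← hn] at hℓ
  obtain ⟨D, hD⟩ : ∃ D, D = (d + 1) * P := ⟨_, rfl⟩
  rw [← hD] at hℓ
  have hP0 : 0 < P := by rw [hP]; positivity
  have hD0 : 0 < D := by rw [hD]; positivity
  have hM : ∃ M : ℕ, (D:ℝ) ^ d * (2 * ((C * (n * Real.exp (-κ * ℓ)) + 2 * (1 - α ^ n) ^ M) * ((n:ℝ) + 1) ^ (d + 1))) < b := by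
    have h1 : Tendsto (fun M : ℕ => (1 - α ^ n) ^ M) atTop (nhds 0) := by
      apply tendsto_pow_atTop_nhds_zero_of_lt_one
      · exact sub_nonneg.2 (pow_le_one₀ hG.α_pos.le hα1)
      · have := pow_pos hG.α_pos n
        linarith
    have h2 : Tendsto (fun M : ℕ => (D:ℝ) ^ d * (2 * ((C * (n * Real.exp (-κ * ℓ)) + 2 * (1 - α ^ n) ^ M) * ((n:ℝ) + 1) ^ (d + 1))))
      atTop (nhds ((D:ℝ) ^ d * (2 * ((C * (n * Real.exp (-κ * ℓ)) + 2 * 0) * ((n:ℝ) + 1) ^ (d + 1))))) :=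
      (((h1.const_mul 2).const_add _).mul_const _).const_mul 2 |>.const_mul _
    rw [mul_zero, add_zero] at h2
    exact (h2.eventually (gt_mem_nhds hℓ)).exists
  obtain ⟨M, hM⟩ := hM
  let Wf : Finset (Site d) → Finset (Site d) := fun S => S.biUnion (YF D)
  let l : Finset (Site d) → List (Site d) := fun S => sweepL (lsM ℓ (2 * ℓ + 1) P M (Wf S)) (d + 1)
  refine ⟨D, hD0, (d + 1) * (M * (3 * D) ^ d), l, fun S => ⟨?_, fun q hq => ?_⟩⟩
  · have h1 := sweepL_filter_len (lsM ℓ (2 * ℓ + 1) P M (Wf S)) (fun x => decide (x ∈ Wf S)) (M * (Wf S).card) (d + 1)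
      (fun c => lsM_filter_len _ _ _ _ _ _ _)
    have h2 : (l S).filter (fun x => decide (x ∈ Wf S)) = l S := by
      rw [List.filter_eq_self]
      have : ∀ k, ∀ x ∈ sweepL (lsM ℓ (2 * ℓ + 1) P M (Wf S)) k, x ∈ Wf S := by
        intro k
        induction k with
        | zero => simp [sweepL]
        | succ k ih =>
          intro x hx
          rw [sweepL, List.mem_append] at hx
          rcases hx with hx | hx
          · exact ih x hx
          · exact (mem_lstS.1 (mem_lsM hx)).1
      intro x hx
      simpa using this _ x hx
    rw [h2] at h1
    refine h1.trans ?_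
    have h3 : (Wf S).card ≤ S.card * (3 * D) ^ d :=
      Finset.card_biUnion_le_card_mul _ _ _ fun q _ => (YF_card D q).le
    calc _ ≤ (d + 1) * (M * (S.card * (3 * D) ^ d)) := by gcongr
      _ = _ := by ring
  have hloc : (∀ (L : List (Site d × Th d)) (ω ω' : Config d), L.map Prod.fst = l S → (∀ x ∈ YF D q, ω x = ω' x) →
          ∀ x, cellOf D x = q → Phi L ω x = Phi (L.filter (fun r => decide (r.1 ∈ YF D q))) ω' x) := by
    intro L ω ω' hL h x hx
    refine sweep_loc (lsM ℓ (2 * ℓ + 1) P M (Wf S)) (fun c => c * (2 * ℓ + 1)) hP0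
      (fun c x hx => (mem_lstS.1 (mem_lsM hx)).2.1) (fun z => decide (z ∈ YF D q)) (d + 1) L ω ω' hL
      (fun x hx => h x (by simpa using hx)) x ?_
    intro z hz
    simp only [decide_eq_true_eq]
    refine near_YF hD0 hx fun k => ?_
    rw [hD]
    exact_mod_cast hz k
  refine ⟨hloc, ?_, ?_⟩
  · refine sweepL_filter_len _ _ _ _ fun c => ?_
    have := lsM_filter_len ℓ (2 * ℓ + 1) P M (Wf S) c (YF D q)
    rwa [YF_card] at this
  · have e1 : Av w ((l S).filter (fun x => decide (x ∈ YF D q))) (badI D q) = Av w (l S) (badI D q) := by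
      have := Av_factor w (fun x => decide (x ∈ YF D q)) (l S) (badI D q) (fun _ => 1)
      rw [Av_const, hG.w_sum, one_pow, mul_one, mul_one] at this
      rw [← this]
      refine Av_congr _ _ _ _ fun L hL => ?_
      rw [mul_one]
      unfold badI
      have : Bad D q (L.filter (fun r => decide (r.1 ∈ YF D q))) ↔ Bad D q L := by
        unfold Bad
        refine exists_congr fun ω => exists_congr fun ω' => exists_congr fun x => and_congr_right fun hx => ?_
        rw [hloc L ω ω hL (fun _ _ => rfl) x hx, hloc L ω' ω' hL (fun _ _ => rfl) x hx]
      rw [this]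
    rw [e1]
    refine (Av_mono hG.w_nonneg _ _ _ fun L _ => badI_le D hD0 q L).trans ?_
    rw [Av_sum]
    have h2 : ∀ x ∈ cellF D q, Av w (l S) (fun L => ind x (Phi L ⊤) - ind x (Phi L ⊥)) ≤
        2 * ((C * (n * Real.exp (-κ * ℓ)) + 2 * (1 - α ^ n) ^ M) * ((n:ℝ) + 1) ^ (d + 1)) := by
      intro x hx
      rw [mem_cellF hD0] at hx
      have e2 : Av w (l S) (fun L => ind x (Phi L ⊤) - ind x (Phi L ⊥)) = Pop w (l S) (ind x) ⊤ - Pop w (l S) (ind x) ⊥ := by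
        have := Av_add w (l S) (fun L => ind x (Phi L ⊤)) (fun L => (-1) * ind x (Phi L ⊥))
        rw [Av_mul_left] at this
        unfold Pop
        rw [show (fun L => ind x (Phi L ⊤) - ind x (Phi L ⊥)) = (fun L => ind x (Phi L ⊤) + (-1) * ind x (Phi L ⊥)) from by
          funext L; ring, this]
        ring
      rw [e2]
      refine sweep_top_bot hG hG' ℓ hP M (Wf S) n hn _ rfl x fun z hz => ?_
      refine Finset.mem_biUnion.2 ⟨q, hq, near_YF hD0 hx fun k => ?_⟩
      rw [hD]
      exact_mod_cast hz k
    refine (Finset.sum_le_card_nsmul _ _ _ h2).trans ?_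
    rw [cellF_card, nsmul_eq_mul]
    push_cast
    exact hM.le

end Cells
end IsingP

open MeasureTheory Filter

namespace IsingP
section Contract
variable {d : ℕ}

def UF (D : ℕ) (S : Finset (Site d)) : Set (Site d) := {x | cellOf D x ∈ S}

theorem UF_finite {D : ℕ} (hD : 0 < D) (S : Finset (Site d)) : (UF D S).Finite := by
  classical
  refine (S.biUnion (cellF D)).finite_toSet.subset fun x hx => ?_
  simp only [Finset.coe_biUnion, Set.mem_iUnion]
  exact ⟨cellOf D x, hx, (mem_cellF hD).2 rfl⟩

noncomputable def nb3 (q : Site d) : Finset (Site d) := Finset.Icc (fun k => q k - 1) (fun k => q k + 1)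

theorem mem_nb3 {q x : Site d} : x ∈ nb3 q ↔ ∀ k, |x k - q k| ≤ 1 := by
  unfold nb3
  rw [Finset.mem_Icc, Pi.le_def, Pi.le_def, ← forall_and]
  refine forall_congr' fun k => ?_
  rw [abs_le]
  constructor <;> rintro ⟨a, b⟩ <;> constructor <;> linarith

theorem nb3_card (q : Site d) : (nb3 q).card = 3 ^ d := by
  unfold nb3
  rw [Pi.card_Icc]
  simp only [Int.card_Icc]
  rw [Finset.prod_congr rfl (g := fun _ => 3)]
  · simp
  · intro k _
    have : q k + 1 + 1 - (q k - 1) = ((3 : ℕ) : ℤ) := by push_cast; ring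
    rw [this, Int.toNat_natCast]

open Classical in
noncomputable def star3 (S : Finset (Site d)) : Finset (Site d) := S.biUnion nb3

theorem star3_card (S : Finset (Site d)) : (star3 S).card ≤ S.card * 3 ^ d := by
  unfold star3
  classical
  exact Finset.card_biUnion_le_card_mul _ _ _ fun q _ => (nb3_card q).le

theorem sub_star3 (S : Finset (Site d)) : S ⊆ star3 S := by
  intro q hq
  unfold star3
  exact Finset.mem_biUnion.2 ⟨q, hq, mem_nb3.2 fun k => by simp⟩

/-- separated subset -/
theorem exists_sep (S : Finset (Site d)) : ∃ T ⊆ S, S.card ≤ 3 ^ d * T.card ∧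
    ∀ q ∈ T, ∀ q' ∈ T, q ≠ q' → ∀ D : ℕ, 0 < D → ∀ x, x ∈ YF D q → x ∉ YF D q' := by
  classical
  obtain ⟨y, _, hy⟩ := Finset.exists_le_card_fiber_of_nsmul_le_card_of_maps_to (s := S)
    (t := (Finset.univ : Finset (Fin d → ZMod 3))) (f := fun q k => ((q k : ℤ) : ZMod 3))
    (b := (S.card : ℚ) / 3 ^ d) (fun _ _ => Finset.mem_univ _) ⟨0, Finset.mem_univ _⟩ (by
      simp only [Finset.card_univ, Fintype.card_pi, ZMod.card, Finset.prod_const, Fintype.card_fin, nsmul_eq_mul]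
      push_cast
      rw [mul_div_cancel₀]
      positivity)
  refine ⟨S.filter (fun q => (fun k => ((q k : ℤ) : ZMod 3)) = y), Finset.filter_subset _ _, ?_, ?_⟩
  · rw [div_le_iff₀ (by positivity)] at hy
    rw [mul_comm]
    exact_mod_cast hy
  · intro q hq q' hq' hne D hD x hx hx'
    apply hne
    funext k
    have h1 := (mem_YF hD).1 hx k
    have h2 := (mem_YF hD).1 hx' k
    have e1 := congrFun (Finset.mem_filter.1 hq).2 k
    have e2 := congrFun (Finset.mem_filter.1 hq').2 k
    have e3 : ((q k : ℤ) : ZMod 3) = ((q' k : ℤ) : ZMod 3) := by rw [e1, e2]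
    rw [ZMod.intCast_eq_intCast_iff] at e3
    have e4 := Int.emod_emod_of_dvd
    unfold Int.ModEq at e3
    rw [abs_le] at h1 h2
    push_cast at e3
    omega

structure Ctx (Dom : Set (ℂ × ℂ)) (D n : ℕ) (l : Finset (Site d) → List (Site d)) (w w' : Th d → ℝ)
    (b b1 : ℝ) : Prop where
  hD : 0 < D
  w_nonneg : ∀ u, 0 ≤ w u
  w_sum : ∑ u, w u = 1
  ww' : ∀ u, w u ≤ w' u
  mn : (∑ u, w' u) ^ n ≤ 1 + b
  b_pos : 0 < b
  b_le : b + b ≤ b1 ^ (3 ^ d)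
  b1_pos : 0 < b1
  b1_le : 4 * (b1 * 2 ^ (3 ^ d)) ≤ 1 / 4
  len : ∀ S, (l S).length ≤ n * S.card
  loc : ∀ S, ∀ q ∈ S, ∀ (L : List (Site d × Th d)) (ω ω' : Config d), L.map Prod.fst = l S →
    (∀ x ∈ YF D q, ω x = ω' x) →
          ∀ x, cellOf D x = q → Phi L ω x = Phi (L.filter (fun r => decide (r.1 ∈ YF D q))) ω' x
  flen : ∀ S, ∀ q ∈ S, ((l S).filter (fun x => decide (x ∈ YF D q))).length ≤ n
  bad : ∀ S, ∀ q ∈ S, Av w ((l S).filter (fun x => decide (x ∈ YF D q))) (badI D q) ≤ b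
  diff : ∀ u, DifferentiableOn ℂ (fun p => wC d p u) Dom
  bound : ∀ p ∈ Dom, ∀ u, ‖wC d p u‖ ≤ w' u

variable {Dom : Set (ℂ × ℂ)} {D n : ℕ} {l : Finset (Site d) → List (Site d)} {w w' : Th d → ℝ} {b b1 : ℝ}

open Classical in
noncomputable def BadS (D : ℕ) (S : Finset (Site d)) (L : List (Site d × Th d)) : Finset (Site d) :=
  S.filter (fun q => Bad D q L)

open Classical in
noncomputable def piece (D : ℕ) (l : Finset (Site d) → List (Site d)) (S S' : Finset (Site d))
    (f : ℂ × ℂ → Config d → ℂ) (p : ℂ × ℂ) (ω : Config d) : ℂ :=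
  Av (wC d p) (l S) (fun L => if BadS D S L = S' then f p (Phi L ω) else 0)

theorem piece_sum (S : Finset (Site d)) (f : ℂ × ℂ → Config d → ℂ) (p : ℂ × ℂ) (ω : Config d) :
    Pop (wC d p) (l S) (f p) ω = ∑ S' ∈ S.powerset, piece D l S S' f p ω := by
  classical
  unfold piece Pop
  rw [← Av_sum]
  refine Av_congr _ _ _ _ fun L _ => ?_
  rw [Finset.sum_ite_eq, if_pos]
  rw [Finset.mem_powerset]
  unfold BadS
  exact Finset.filter_subset _ _

theorem piece_loc (hc : Ctx Dom D n l w w' b b1) (S S' : Finset (Site d)) (f : ℂ × ℂ → Config d → ℂ) (p : ℂ × ℂ)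
    (hf : Loc (UF D S) (f p)) : Loc (UF D (star3 S')) (piece D l S S' f p) := by
  classical
  intro ω ω' h
  unfold piece
  refine Av_congr _ _ _ _ fun L hL => ?_
  split_ifs with hB
  · refine hf _ _ fun x hx => ?_
    by_cases hq : Bad D (cellOf D x) L
    · have hxS : cellOf D x ∈ S' := by
        rw [← hB]; unfold BadS; exact Finset.mem_filter.2 ⟨hx, hq⟩
      rw [hc.loc S _ hx L ω ω' hL (fun z hz => h z ?_) x rfl, hc.loc S _ hx L ω' ω' hL (fun _ _ => rfl) x rfl]
      have := (mem_YF hc.hD).1 hz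
      unfold star3
      exact Finset.mem_biUnion.2 ⟨_, hxS, mem_nb3.2 this⟩
    · by_contra hne
      exact hq ⟨ω, ω', x, rfl, hne⟩
  · rfl

theorem Ctx.one_le (hc : Ctx Dom D n l w w' b b1) : 1 ≤ ∑ u, w' u := by
  rw [← hc.w_sum]; exact Finset.sum_le_sum fun u _ => hc.ww' u

theorem badI_nonneg (q : Site d) (L) : 0 ≤ badI D q L := by unfold badI; split_ifs <;> norm_num
theorem badI_le_one (q : Site d) (L) : badI D q L ≤ 1 := by unfold badI; split_ifs <;> norm_num

theorem Ctx.b1_le_one (hc : Ctx Dom D n l w w' b b1) : b1 ≤ 1 := by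
  have h1 := hc.b1_le
  have h2 : (1:ℝ) ≤ 2 ^ (3 ^ d) := one_le_pow₀ (by norm_num)
  nlinarith [hc.b1_pos]

theorem piece_bound (hc : Ctx Dom D n l w w' b b1) (S S' : Finset (Site d)) (hS : S' ⊆ S)
    (f : ℂ × ℂ → Config d → ℂ) (p : ℂ × ℂ) (hp : p ∈ Dom) (a : ℝ) (ha : 0 ≤ a) (hf : ∀ ω, ‖f p ω‖ ≤ a) (ω) :
    ‖piece D l S S' f p ω‖ ≤ a * (b1 ^ S'.card * (1 + b) ^ S.card) := by
  classical
  obtain ⟨T, hTS, hTc, hTd⟩ := exists_sep S'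
  have hw'0 : ∀ u, 0 ≤ w' u := fun u => (hc.w_nonneg u).trans (hc.ww' u)
  unfold piece
  refine (Av_norm_le (hc.bound p hp) (l S) _ (fun L => a * ∏ q ∈ T, badI D q (L.filter (fun r => decide (r.1 ∈ YF D q)))) ?_).trans ?_
  · intro L hL
    split_ifs with hB
    · have : ∏ q ∈ T, badI D q (L.filter (fun r => decide (r.1 ∈ YF D q))) = 1 := by
        refine Finset.prod_eq_one fun q hq => ?_
        have hqB : q ∈ BadS D S L := by rw [hB]; exact hTS hq
        unfold BadS at hqB
        obtain ⟨hqS, hqb⟩ := Finset.mem_filter.1 hqB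
        unfold badI
        rw [if_pos]
        obtain ⟨ζ, ζ', x, hx, hne⟩ := hqb
        refine ⟨ζ, ζ', x, hx, ?_⟩
        rwa [← hc.loc S q hqS L ζ ζ hL (fun _ _ => rfl) x hx, ← hc.loc S q hqS L ζ' ζ' hL (fun _ _ => rfl) x hx]
      rw [this, mul_one]
      exact hf _
    · rw [norm_zero]
      exact mul_nonneg ha (Finset.prod_nonneg fun q _ => badI_nonneg _ _)
  · rw [Av_mul_left]
    refine mul_le_mul_of_nonneg_left ?_ ha
    have hε : ∀ q ∈ T, Av w' ((l S).filter (fun x => decide (x ∈ YF D q))) (badI D q) ≤ b1 ^ (3 ^ d) := by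
      intro q hq
      have hqS := hS (hTS hq)
      have h1 := Av_le_add hc.w_nonneg hc.ww' hc.w_sum ((l S).filter (fun x => decide (x ∈ YF D q))) (badI D q)
        (fun L _ => badI_le_one q L)
      have h2 := hc.bad S q hqS
      have h3 : (∑ u, w' u) ^ ((l S).filter (fun x => decide (x ∈ YF D q))).length ≤ 1 + b :=
        (pow_le_pow_right₀ hc.one_le (hc.flen S q hqS)).trans hc.mn
      have := hc.b_le
      linarith
    refine (Av_prod_le hw'0 hc.one_le T (fun q x => decide (x ∈ YF D q))
      (fun q hq q' hq' hne x hx => by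
        have := hTd q hq q' hq' hne D hc.hD x (by simpa using hx)
        simpa using this) (fun q => badI D q) (fun q L => badI_nonneg q L) _ (l S) hε (by have := hc.b1_pos; positivity)).trans ?_
    refine mul_le_mul ?_ ?_ (pow_nonneg (zero_le_one.trans hc.one_le) _) (by have := hc.b1_pos; positivity)
    · rw [← pow_mul]
      exact pow_le_pow_of_le_one hc.b1_pos.le hc.b1_le_one hTc
    · refine (pow_le_pow_right₀ hc.one_le (hc.len S)).trans ?_
      rw [pow_mul]
      exact pow_le_pow_left₀ (pow_nonneg (zero_le_one.trans hc.one_le) _) hc.mn _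

theorem piece_diff (hc : Ctx Dom D n l w w' b b1) (S S' : Finset (Site d))
    (f : ℂ × ℂ → Config d → ℂ) (hf : ∀ ω, DifferentiableOn ℂ (fun p => f p ω) Dom) (ω) :
    DifferentiableOn ℂ (fun p => piece D l S S' f p ω) Dom := by
  unfold piece
  refine Av_differentiableOn hc.diff _ _ fun L => ?_
  split_ifs
  · exact hf _
  · exact differentiableOn_const 0

theorem Ctx.b_half (hc : Ctx Dom D n l w w' b b1) : b ≤ 1 / 2 := by
  have := hc.b_le
  have : b1 ^ (3 ^ d) ≤ 1 := pow_le_one₀ hc.b1_pos.le hc.b1_le_one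
  linarith

theorem weight_sum (hc : Ctx Dom D n l w w' b b1) (S : Finset (Site d)) :
    ∑ S' ∈ S.powerset.erase ∅, (b1 ^ S'.card * (1 + b) ^ S.card) * 2 ^ (star3 S').card ≤ 2 ^ S.card / 4 := by
  set B := b1 * 2 ^ (3 ^ d) with hB
  have hb1 := hc.b1_pos
  have hB0 : 0 < B := by positivity
  have hb := hc.b_pos
  have h4 : 4 * B ≤ 1 / 4 := hc.b1_le
  calc _ ≤ ∑ S' ∈ S.powerset.erase ∅, (1 / 4) * ((4 * B) ^ S'.card * (1 + b) ^ S.card) := by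
        refine Finset.sum_le_sum fun S' hS' => ?_
        have hne : S' ≠ ∅ := (Finset.mem_erase.1 hS').1
        have hc1 : 1 ≤ S'.card := Finset.card_pos.2 (Finset.nonempty_iff_ne_empty.2 hne)
        have h1 : (2:ℝ) ^ (star3 S').card ≤ (2 ^ (3 ^ d)) ^ S'.card := by
          rw [← pow_mul]
          refine pow_le_pow_right₀ (by norm_num) ?_
          rw [mul_comm]; exact star3_card S'
        have h2 : (4:ℝ) ≤ 4 ^ S'.card := by
          calc (4:ℝ) = 4 ^ 1 := by norm_num
            _ ≤ _ := pow_le_pow_right₀ (by norm_num) hc1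
        calc _ ≤ (b1 ^ S'.card * (1 + b) ^ S.card) * (2 ^ (3 ^ d)) ^ S'.card := by gcongr
          _ = B ^ S'.card * (1 + b) ^ S.card := by rw [hB, mul_pow]; ring
          _ ≤ (1/4) * 4 ^ S'.card * (B ^ S'.card * (1 + b) ^ S.card) :=
            le_mul_of_one_le_left (by positivity) (by linarith)
          _ = _ := by rw [mul_pow]; ring
    _ ≤ ∑ S' ∈ S.powerset, (1 / 4) * ((4 * B) ^ S'.card * (1 + b) ^ S.card) :=
        Finset.sum_le_sum_of_subset_of_nonneg (Finset.erase_subset _ _) fun _ _ _ => by positivity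
    _ = (1 / 4) * ((4 * B + 1) ^ S.card * (1 + b) ^ S.card) := by
        rw [← Finset.mul_sum, ← Finset.sum_mul, ← Finset.sum_pow_mul_eq_add_pow (4 * B) 1 S]
        simp
    _ = (1 / 4) * ((4 * B + 1) * (1 + b)) ^ S.card := by rw [mul_pow]
    _ ≤ (1 / 4) * 2 ^ S.card := by
        have := hc.b_half
        gcongr
        nlinarith
    _ = _ := by ring

/-- finite representation with weighted norm -/
def Rep (Dom : Set (ℂ × ℂ)) (D : ℕ) (A : ℝ) (g : ℂ × ℂ → Config d → ℂ) : Prop :=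
  ∃ (ι : Type) (_ : Fintype ι) (S : ι → Finset (Site d)) (f : ι → ℂ × ℂ → Config d → ℂ) (a : ι → ℝ),
    (∀ i, 0 ≤ a i) ∧ (∀ i p, Loc (UF D (S i)) (f i p)) ∧
    (∀ i ω, DifferentiableOn ℂ (fun p => f i p ω) Dom) ∧
    (∀ i, ∀ p ∈ Dom, ∀ ω, ‖f i p ω‖ ≤ a i) ∧ ∑ i, a i * 2 ^ (S i).card ≤ A ∧
    ∀ p ω, g p ω = ∑ i, f i p ω

theorem Rep.bound {A : ℝ} {g : ℂ × ℂ → Config d → ℂ} (h : Rep Dom D A g) :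
    ∀ p ∈ Dom, ∀ ω, ‖g p ω‖ ≤ A := by
  obtain ⟨ι, _, S, f, a, ha, -, -, hb, hs, hg⟩ := h
  intro p hp ω
  rw [hg]
  refine (norm_sum_le _ _).trans (le_trans (Finset.sum_le_sum fun i _ => ?_) hs)
  refine (hb i p hp ω).trans ?_
  exact le_mul_of_one_le_right (ha i) (one_le_pow₀ (by norm_num))

theorem Rep.nonneg {A : ℝ} {g : ℂ × ℂ → Config d → ℂ} (h : Rep Dom D A g) : 0 ≤ A := by
  obtain ⟨ι, _, S, f, a, ha, -, -, hb, hs, hg⟩ := h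
  exact le_trans (Finset.sum_nonneg fun i _ => mul_nonneg (ha i) (by positivity)) hs

theorem Rep.step (hc : Ctx Dom D n l w w' b b1) {A : ℝ} {g : ℂ × ℂ → Config d → ℂ} (h : Rep Dom D A g) :
    ∃ c : ℂ × ℂ → ℂ, DifferentiableOn ℂ c Dom ∧ (∀ p ∈ Dom, ‖c p‖ ≤ A) ∧
      ∃ g', Rep Dom D (A / 4) g' ∧ ∀ᶠ N in atTop, ∀ β h : ℝ,
        nuN d N β h (g ((β : ℂ), (h : ℂ))) = c ((β : ℂ), (h : ℂ)) + nuN d N β h (g' ((β : ℂ), (h : ℂ))) := by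
  classical
  obtain ⟨ι, _, S, f, a, ha, hl, hd, hb, hs, hg⟩ := h
  have hbp := hc.b_pos
  refine ⟨fun p => ∑ i, piece D l (S i) ∅ (f i) p ⊤, ?_, ?_,
    fun p ω => ∑ i, ∑ S' ∈ (S i).powerset.erase ∅, piece D l (S i) S' (f i) p ω, ?_, ?_⟩
  · exact DifferentiableOn.fun_sum fun i _ => piece_diff hc _ _ _ (hd i) _
  · intro p hp
    refine (norm_sum_le _ _).trans (le_trans (Finset.sum_le_sum fun i _ => ?_) hs)
    refine (piece_bound hc (S i) ∅ (Finset.empty_subset _) (f i) p hp (a i) (ha i) (hb i p hp) _).trans ?_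
    refine mul_le_mul_of_nonneg_left ?_ (ha i)
    rw [Finset.card_empty, pow_zero, one_mul]
    have := hc.b_half
    gcongr
    linarith
  · refine ⟨Σ i, {S' // S' ∈ (S i).powerset.erase ∅}, inferInstance, fun j => star3 j.2.1,
      fun j => piece D l (S j.1) j.2.1 (f j.1), fun j => a j.1 * (b1 ^ j.2.1.card * (1 + b) ^ (S j.1).card), ?_, ?_, ?_, ?_, ?_, ?_⟩
    · rintro ⟨i, S', hS'⟩
      have := hc.b1_pos
      have := ha i
      positivity
    · rintro ⟨i, S', hS'⟩ p
      exact piece_loc hc _ _ _ _ (hl i p)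
    · rintro ⟨i, S', hS'⟩ ω
      exact piece_diff hc _ _ _ (hd i) _
    · rintro ⟨i, S', hS'⟩ p hp ω
      exact piece_bound hc _ _ (Finset.mem_powerset.1 (Finset.mem_erase.1 hS').2) _ p hp _ (ha i) (hb i p hp) _
    · rw [Fintype.sum_sigma]
      have : ∀ i, ∑ y : {S' // S' ∈ (S i).powerset.erase ∅},
          a i * (b1 ^ y.1.card * (1 + b) ^ (S i).card) * 2 ^ (star3 y.1).card ≤ a i * 2 ^ (S i).card / 4 := by
        intro i
        rw [Finset.sum_coe_sort ((S i).powerset.erase ∅) (fun S' => a i * (b1 ^ S'.card * (1 + b) ^ (S i).card) * 2 ^ (star3 S').card)]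
        simp only [mul_assoc (a i)]
        rw [← Finset.mul_sum, mul_div_assoc]
        exact mul_le_mul_of_nonneg_left (weight_sum hc (S i)) (ha i)
      refine (Finset.sum_le_sum fun i _ => this i).trans ?_
      rw [← Finset.sum_div]
      linarith
    · intro p ω
      rw [Fintype.sum_sigma]
      refine Finset.sum_congr rfl fun i _ => ?_
      rw [Finset.sum_coe_sort ((S i).powerset.erase ∅) (fun S' => piece D l (S i) S' (f i) p ω)]
  · have hinv : ∀ᶠ N : ℕ in atTop, ∀ i, ∀ (β h : ℝ) (g : Config d → ℂ), Loc (UF D (S i)) g →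
      nuN d N β h (Pop (wC d ((β : ℂ), (h : ℂ))) (l (S i)) g) = nuN d N β h g :=
      eventually_all.2 fun i => nuN_inv (l (S i)) _ (UF_finite hc.hD _)
    filter_upwards [hinv, eventually_gt_atTop 0] with N hN hN0 β h
    set p : ℂ × ℂ := ((β : ℂ), (h : ℂ)) with hp
    have e0 : g p = fun ω => ∑ i, f i p ω := funext (hg p)
    rw [e0, nuN_sum, nuN_sum, ← Finset.sum_add_distrib]
    refine Finset.sum_congr rfl fun i _ => ?_
    rw [← hN i β h _ (hl i p)]
    have e1 : Pop (wC d p) (l (S i)) (f i p) = fun ω => (fun _ => piece D l (S i) ∅ (f i) p ⊤) ω +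
        ∑ S' ∈ (S i).powerset.erase ∅, piece D l (S i) S' (f i) p ω := by
      funext ω
      rw [piece_sum (D := D), ← Finset.add_sum_erase _ _ (Finset.empty_mem_powerset (S i))]
      congr 1
      refine piece_loc hc (S i) ∅ (f i) p (hl i p) _ _ fun x hx => ?_
      exact absurd hx (by simp [UF, star3])
    rw [← hp, e1, nuN_add, nuN_const N hN0]

theorem Rep.iterate (hc : Ctx Dom D n l w w' b b1) {A : ℝ} {g : ℂ × ℂ → Config d → ℂ} (h : Rep Dom D A g) :
    ∃ c : ℕ → ℂ × ℂ → ℂ, (∀ k, DifferentiableOn ℂ (c k) Dom) ∧ (∀ k, ∀ p ∈ Dom, ‖c k p‖ ≤ A * (1 / 4) ^ k) ∧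
      ∀ k, ∀ᶠ N in atTop, ∀ β h : ℝ, ((β : ℂ), (h : ℂ)) ∈ Dom →
        ‖nuN d N β h (g ((β : ℂ), (h : ℂ))) - ∑ j ∈ Finset.range k, c j ((β : ℂ), (h : ℂ))‖ ≤ A * (1 / 4) ^ k := by
  classical
  have hst : ∀ s : {x : ℝ × (ℂ × ℂ → Config d → ℂ) // Rep Dom D x.1 x.2}, ∃ c : ℂ × ℂ → ℂ,
      ∃ s' : {x : ℝ × (ℂ × ℂ → Config d → ℂ) // Rep Dom D x.1 x.2}, s'.1.1 = s.1.1 / 4 ∧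
      DifferentiableOn ℂ c Dom ∧ (∀ p ∈ Dom, ‖c p‖ ≤ s.1.1) ∧ ∀ᶠ N in atTop, ∀ β h : ℝ,
        nuN d N β h (s.1.2 ((β : ℂ), (h : ℂ))) = c ((β : ℂ), (h : ℂ)) + nuN d N β h (s'.1.2 ((β : ℂ), (h : ℂ))) := by
    rintro ⟨⟨A, g⟩, hs⟩
    obtain ⟨c, h1, h2, g', h3, h4⟩ := Rep.step hc hs
    exact ⟨c, ⟨⟨A / 4, g'⟩, h3⟩, rfl, h1, h2, h4⟩
  choose cc nx e1 e2 e3 e4 using hst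
  let sq : ℕ → {x : ℝ × (ℂ × ℂ → Config d → ℂ) // Rep Dom D x.1 x.2} := fun k => nx^[k] ⟨⟨A, g⟩, h⟩
  have hsucc : ∀ k, sq (k + 1) = nx (sq k) := fun k => Function.iterate_succ_apply' _ _ _
  have hA : ∀ k, (sq k).1.1 = A * (1 / 4) ^ k := by
    intro k
    induction k with
    | zero => simp [sq]
    | succ k ih => rw [hsucc, e1, ih, pow_succ]; ring
  refine ⟨fun k => cc (sq k), fun k => e2 _, fun k p hp => ?_, fun k => ?_⟩
  · rw [← hA]; exact e3 _ p hp
  · have : ∀ᶠ N in atTop, ∀ β h : ℝ, nuN d N β h (g ((β : ℂ), (h : ℂ))) =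
        ∑ j ∈ Finset.range k, cc (sq j) ((β : ℂ), (h : ℂ)) + nuN d N β h ((sq k).1.2 ((β : ℂ), (h : ℂ))) := by
      induction k with
      | zero => exact Eventually.of_forall fun N β h => by simp [sq]
      | succ k ih =>
        filter_upwards [ih, e4 (sq k)] with N h1 h2 β h
        rw [h1, h2, Finset.sum_range_succ, hsucc]; ring
    filter_upwards [this] with N hN β h hp
    rw [hN, add_sub_cancel_left, ← hA]
    exact nuN_norm_le _ _ _ _ _ ((sq k).2.bound _ hp) (sq k).2.nonneg

end Contract
end IsingP

open MeasureTheory Filter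
namespace IsingP

abbrev JJ : Type := ↥(Set.Icc (0:ℝ) (2 * Real.pi))

noncomputable def mJ : Measure JJ := Measure.comap Subtype.val volume

instance mJ_finite : IsFiniteMeasure mJ := by
  constructor
  rw [mJ, comap_subtype_coe_apply measurableSet_Icc]
  refine lt_of_le_of_lt (measure_mono (t := Set.Icc (0:ℝ) (2 * Real.pi)) ?_)
    (by rw [Real.volume_Icc]; exact ENNReal.ofReal_lt_top)
  rintro _ ⟨x, -, rfl⟩
  exact x.2

lemma intable (f : C(JJ × JJ, ℂ)) : Integrable (fun x => f x) (mJ.prod mJ) :=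
  f.continuous.integrable_of_hasCompactSupport (HasCompactSupport.of_compactSpace _)

noncomputable def intC : C(JJ × JJ, ℂ) →L[ℂ] ℂ :=
  LinearMap.mkContinuous
    { toFun := fun φ => ∫ x, φ x ∂(mJ.prod mJ)
      map_add' := fun f g => integral_add (intable f) (intable g)
      map_smul' := fun c f => integral_smul c _ }
    ((mJ.prod mJ).real Set.univ)
    (fun φ => (norm_integral_le_of_norm_le_const
      (Eventually.of_forall (fun x => φ.norm_coe_le_norm x))).trans_eq (mul_comm _ _))

lemma intC_apply (φ : C(JJ × JJ, ℂ)) : intC φ = ∫ x, φ x ∂(mJ.prod mJ) := rfl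

lemma int_JJ (f : ℝ → ℂ) : ∫ s : JJ, f s ∂mJ = ∫ s in (0:ℝ)..(2 * Real.pi), f s := by
  rw [intervalIntegral.integral_of_le Real.two_pi_pos.le, ← integral_Icc_eq_integral_Ioc]
  exact integral_subtype_comap measurableSet_Icc f

lemma intC_eq (φ : C(JJ × JJ, ℂ)) (f : ℝ → ℝ → ℂ) (hf : ∀ s t : JJ, φ (s, t) = f s t) :
    intC φ = ∫ s in (0:ℝ)..(2 * Real.pi), ∫ t in (0:ℝ)..(2 * Real.pi), f s t := by
  rw [intC_apply, integral_prod _ (intable φ)]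
  rw [← int_JJ]
  congr 1; ext s
  rw [← int_JJ]
  congr 1; ext t
  exact hf s t

lemma cauchy1 (f : ℂ → ℂ) (c w : ℂ) (r R : ℝ) (hrR : r < R) (hw : w ∈ Metric.ball c r)
    (hf : DifferentiableOn ℂ f (Metric.ball c R)) :
    ∫ t in (0:ℝ)..(2 * Real.pi), deriv (circleMap c r) t * ((circleMap c r t - w)⁻¹ * f (circleMap c r t))
      = (2 * Real.pi * Complex.I) * f w := by
  have := Complex.circleIntegral_sub_inv_smul_of_differentiable_on_off_countable (f := f)
    Set.countable_empty hw (hf.continuousOn.mono (Metric.closedBall_subset_ball hrR))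
    (fun x hx => hf.differentiableAt (Metric.isOpen_ball.mem_nhds
      (Metric.ball_subset_ball hrR.le hx.1)))
  simpa [circleIntegral] using this

theorem analytic2 (F : ℂ × ℂ → ℂ) (p0 : ℂ × ℂ) (r R : ℝ) (hr : 0 < r) (hrR : r < R)
    (hc : ContinuousOn F (Metric.ball p0 R))
    (h1 : ∀ h ∈ Metric.ball p0.2 R, DifferentiableOn ℂ (fun β => F (β, h)) (Metric.ball p0.1 R))
    (h2 : ∀ β ∈ Metric.ball p0.1 R, DifferentiableOn ℂ (fun h => F (β, h)) (Metric.ball p0.2 R))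
    (p : ℂ × ℂ) (hp : p ∈ Metric.ball p0 r) : AnalyticAt ℂ F p := by
  have hz : ∀ (c : ℂ) (s : ℝ), circleMap c r s ∈ Metric.ball c R := fun c s =>
    Metric.closedBall_subset_ball hrR (circleMap_mem_closedBall c hr.le s)
  have hne : ∀ (c w : ℂ) (s : ℝ), w ∈ Metric.ball c r → circleMap c r s - w ≠ 0 := by
    intro c w s hw h
    rw [sub_eq_zero] at h
    exact circleMap_notMem_ball c r s (h ▸ hw)
  have hbp : ∀ q : ℂ × ℂ, q ∈ Metric.ball p0 r ↔ q.1 ∈ Metric.ball p0.1 r ∧ q.2 ∈ Metric.ball p0.2 r := by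
    intro q
    rw [← ball_prod_same (x := p0.1) (y := p0.2)]
    exact Set.mem_prod
  let G : C(JJ × JJ, ℂ) :=
    ⟨fun x => deriv (circleMap p0.1 r) x.1 * deriv (circleMap p0.2 r) x.2 *
      F (circleMap p0.1 r x.1, circleMap p0.2 r x.2), by
      simp only [deriv_circleMap]
      refine Continuous.mul (by fun_prop) ?_
      refine hc.comp_continuous (by fun_prop) ?_
      intro x
      rw [← ball_prod_same (x := p0.1) (y := p0.2)]
      exact ⟨hz _ _, hz _ _⟩⟩
  let Z : C(JJ × JJ, ℂ) := ⟨fun x => circleMap p0.1 r x.1, by fun_prop⟩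
  let W : C(JJ × JJ, ℂ) := ⟨fun x => circleMap p0.2 r x.2, by fun_prop⟩
  have hinv : ∀ (Y : C(JJ × JJ, ℂ)), IsUnit Y → ∀ x, (Ring.inverse Y) x = (Y x)⁻¹ := by
    intro Y hY x
    have := Ring.mul_inverse_cancel Y hY
    have := congrArg (fun f : C(JJ × JJ, ℂ) => f x) this
    simp only [ContinuousMap.mul_apply, ContinuousMap.one_apply] at this
    exact eq_inv_of_mul_eq_one_right this
  have hu1 : ∀ q ∈ Metric.ball p0 r, IsUnit (Z - q.1 • (1 : C(JJ × JJ, ℂ))) := by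
    intro q hq
    rw [ContinuousMap.isUnit_iff_forall_ne_zero]
    intro x
    simpa [Z] using hne _ _ _ ((hbp q).1 hq).1
  have hu2 : ∀ q ∈ Metric.ball p0 r, IsUnit (W - q.2 • (1 : C(JJ × JJ, ℂ))) := by
    intro q hq
    rw [ContinuousMap.isUnit_iff_forall_ne_zero]
    intro x
    simpa [W] using hne _ _ _ ((hbp q).1 hq).2
  have key : ∀ q ∈ Metric.ball p0 r, F q = (2 * Real.pi * Complex.I)⁻¹ ^ 2 *
      intC (G * Ring.inverse (Z - q.1 • (1 : C(JJ × JJ, ℂ))) *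
        Ring.inverse (W - q.2 • (1 : C(JJ × JJ, ℂ)))) := by
    intro q hq
    have hq' := (hbp q).1 hq
    rw [intC_eq _ (fun s t => deriv (circleMap p0.1 r) s * ((circleMap p0.1 r s - q.1)⁻¹ *
      (deriv (circleMap p0.2 r) t * ((circleMap p0.2 r t - q.2)⁻¹ *
      F (circleMap p0.1 r s, circleMap p0.2 r t)))))]
    · simp only [intervalIntegral.integral_const_mul]
      have e1 : ∀ s : ℝ, ∫ t in (0:ℝ)..(2 * Real.pi), (deriv (circleMap p0.2 r) t *
          ((circleMap p0.2 r t - q.2)⁻¹ * F (circleMap p0.1 r s, circleMap p0.2 r t))) =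
          (2 * Real.pi * Complex.I) * F (circleMap p0.1 r s, q.2) := fun s =>
        cauchy1 (fun h => F (circleMap p0.1 r s, h)) _ _ r R hrR hq'.2 (h2 _ (hz _ _))
      simp only [e1]
      have e2 := cauchy1 (fun β => (2 * Real.pi * Complex.I) * F (β, q.2)) _ _ r R hrR hq'.1
        ((h1 _ (Metric.ball_subset_ball hrR.le hq'.2)).const_mul _)
      rw [e2]
      have : (2 * Real.pi * Complex.I : ℂ) ≠ 0 := by simp [Real.pi_ne_zero]
      field_simp
    · intro s t
      simp only [ContinuousMap.mul_apply, hinv _ (hu1 q hq), hinv _ (hu2 q hq)]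
      simp [G, Z, W]
      ring
  have ha : AnalyticAt ℂ (fun q : ℂ × ℂ => (2 * Real.pi * Complex.I)⁻¹ ^ 2 *
      intC (G * Ring.inverse (Z - q.1 • (1 : C(JJ × JJ, ℂ))) *
        Ring.inverse (W - q.2 • (1 : C(JJ × JJ, ℂ))))) p := by
    have i1 : AnalyticAt ℂ (fun q : ℂ × ℂ => Ring.inverse (Z - q.1 • (1 : C(JJ × JJ, ℂ)))) p := by
      have h3 : AnalyticAt ℂ (Ring.inverse : C(JJ × JJ, ℂ) → C(JJ × JJ, ℂ))
          (Z - p.1 • (1 : C(JJ × JJ, ℂ))) := analyticAt_inverse (𝕜 := ℂ) (hu1 p hp).unit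
      have h4 : AnalyticAt ℂ (fun q : ℂ × ℂ => Z - q.1 • (1 : C(JJ × JJ, ℂ))) p :=
        analyticAt_const.sub (analyticAt_fst.smul analyticAt_const)
      exact AnalyticAt.comp' (f := fun q : ℂ × ℂ => Z - q.1 • (1 : C(JJ × JJ, ℂ))) h3 h4
    have i2 : AnalyticAt ℂ (fun q : ℂ × ℂ => Ring.inverse (W - q.2 • (1 : C(JJ × JJ, ℂ)))) p := by
      have h3 : AnalyticAt ℂ (Ring.inverse : C(JJ × JJ, ℂ) → C(JJ × JJ, ℂ))
          (W - p.2 • (1 : C(JJ × JJ, ℂ))) := analyticAt_inverse (𝕜 := ℂ) (hu2 p hp).unit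
      have h4 : AnalyticAt ℂ (fun q : ℂ × ℂ => W - q.2 • (1 : C(JJ × JJ, ℂ))) p :=
        analyticAt_const.sub (analyticAt_snd.smul analyticAt_const)
      exact AnalyticAt.comp' (f := fun q : ℂ × ℂ => W - q.2 • (1 : C(JJ × JJ, ℂ))) h3 h4
    refine analyticAt_const.mul ?_
    exact (intC.analyticAt _).comp' ((analyticAt_const.mul i1).mul i2)
  refine ha.congr ?_
  filter_upwards [Metric.isOpen_ball.mem_nhds hp] with q hq
  exact (key q hq).symm

/-- analyticity of a geometric series of holomorphic functions of two variables -/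
theorem analytic_tsum (c : ℕ → ℂ × ℂ → ℂ) (p0 : ℂ × ℂ) (r R A : ℝ) (hr : 0 < r) (hrR : r < R)
    (hd : ∀ k, DifferentiableOn ℂ (c k) (Metric.ball p0 R))
    (hb : ∀ k, ∀ p ∈ Metric.ball p0 R, ‖c k p‖ ≤ A * (1/4) ^ k)
    (p : ℂ × ℂ) (hp : p ∈ Metric.ball p0 r) : AnalyticAt ℂ (fun p => ∑' k, c k p) p := by
  have hs : Summable (fun k : ℕ => A * (1/4 : ℝ) ^ k) :=
    (summable_geometric_of_lt_one (by norm_num) (by norm_num)).mul_left A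
  have hbp : ∀ a ∈ Metric.ball p0.1 R, ∀ b ∈ Metric.ball p0.2 R, (a, b) ∈ Metric.ball p0 R := by
    intro a ha b hb
    rw [← ball_prod_same (x := p0.1) (y := p0.2)]
    exact ⟨ha, hb⟩
  refine analytic2 _ p0 r R hr hrR ?_ ?_ ?_ p hp
  · exact continuousOn_tsum (fun k => (hd k).continuousOn) hs hb
  · intro h hh
    refine Complex.differentiableOn_tsum_of_summable_norm hs (fun k => ?_) Metric.isOpen_ball
      (fun k β hβ => hb k _ (hbp _ hβ _ hh))
    exact (hd k).comp (by fun_prop) (fun β hβ => hbp _ hβ _ hh)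
  · intro β hβ
    refine Complex.differentiableOn_tsum_of_summable_norm hs (fun k => ?_) Metric.isOpen_ball
      (fun k h hh => hb k _ (hbp _ hβ _ hh))
    exact (hd k).comp (by fun_prop) (fun h hh => hbp _ hβ _ hh)

end IsingP

open MeasureTheory Filter
namespace IsingP
variable {d : ℕ}

theorem exists_delta (n m : ℕ) (b : ℝ) (hb : 0 < b) : ∃ δ > 0, (1 + m * δ) ^ n ≤ 1 + b := by
  have hc : ContinuousAt (fun δ : ℝ => (1 + m * δ) ^ n) 0 := by fun_prop
  have h1 : ∀ᶠ δ in nhds (0:ℝ), (1 + m * δ) ^ n < 1 + b := by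
    apply hc.eventually_lt_const
    simp [hb]
  obtain ⟨ε, hε, h⟩ := Metric.eventually_nhds_iff.1 h1
  refine ⟨ε / 2, by positivity, (h ?_).le⟩
  rw [Real.dist_eq, sub_zero, abs_of_pos (by positivity)]
  linarith

theorem rep_init (Dom : Set (ℂ × ℂ)) (D : ℕ) (A : Finset (Site d)) :
    ∃ a : ℝ, 0 ≤ a ∧ Rep Dom D a (fun _ ω => ∏ i ∈ A, (spin (ω i) : ℂ)) := by
  classical
  refine ⟨2 ^ (A.image (cellOf D)).card, by positivity, Unit, inferInstance, fun _ => A.image (cellOf D),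
    fun _ _ ω => ∏ i ∈ A, (spin (ω i) : ℂ), fun _ => 1, fun _ => zero_le_one, ?_, ?_, ?_, by simp, by simp⟩
  · intro _ _ ω ω' h
    refine Finset.prod_congr rfl fun i hi => ?_
    rw [h i]
    exact Finset.mem_image_of_mem _ hi
  · intro _ ω
    exact differentiableOn_const _
  · intro _ p _ ω
    rw [norm_prod]
    refine Finset.prod_le_one (fun _ _ => norm_nonneg _) fun i _ => ?_
    cases h : ω i <;> simp [spin]

theorem ctx_exists (β₀ h₀ : ℝ) (hβ₀ : 0 ≤ β₀) (μ : Measure (Config d)) (hG : IsGibbs d β₀ h₀ μ)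
    (hW : WeakMixing d μ) : ∃ R > 0, ∃ D n l w w' b b1,
      Ctx (d := d) (Metric.ball ((β₀ : ℂ), (h₀ : ℂ)) R) D n l w w' b b1 := by
  obtain ⟨α, C, c, ν, hg, hg'⟩ := good_exists β₀ h₀ hβ₀ μ hG hW
  obtain ⟨b1, hb1⟩ : ∃ b1 : ℝ, b1 = (2 ^ (3 ^ d))⁻¹ / 16 := ⟨_, rfl⟩
  have hb1p : 0 < b1 := by rw [hb1]; positivity
  obtain ⟨b, hb⟩ : ∃ b : ℝ, b = b1 ^ (3 ^ d) / 2 := ⟨_, rfl⟩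
  have hbp : 0 < b := by rw [hb]; positivity
  obtain ⟨D, hD, n, l, hl⟩ := sweep_exists hg hg' b hbp
  obtain ⟨δ, hδ, hδn⟩ := exists_delta n (2 * d + 2) b hbp
  obtain ⟨R, hR, hdiff, hbd⟩ := wC_good (d := d) β₀ h₀ δ hδ hβ₀
  refine ⟨R, hR, D, n, l, wR d β₀ h₀, fun u => wR d β₀ h₀ u + δ, b, b1, ?_⟩
  exact
    { hD := hD
      w_nonneg := hg.w_nonneg
      w_sum := hg.w_sum
      ww' := fun u => by linarith
      mn := by
        rw [Finset.sum_add_distrib, hg.w_sum]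
        simpa using hδn
      b_pos := hbp
      b_le := by rw [hb]; linarith
      b1_pos := hb1p
      b1_le := by
        rw [hb1]
        have : (2 ^ (3 ^ d) : ℝ) ≠ 0 := by positivity
        have e : (4 * ((2 ^ (3 ^ d))⁻¹ / 16 * 2 ^ (3 ^ d)) : ℝ) = 1 / 4 := by
          field_simp; norm_num
        exact e.le
      len := fun S => (hl S).1
      loc := fun S q hq => ((hl S).2 q hq).1
      flen := fun S q hq => ((hl S).2 q hq).2.1
      bad := fun S q hq => ((hl S).2 q hq).2.2
      diff := hdiff
      bound := hbd }

theorem main_aux (β₀ h₀ : ℝ) (hβ₀ : 0 ≤ β₀) (μ : Measure (Config d)) (hG : IsGibbs d β₀ h₀ μ)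
    (hW : WeakMixing d μ) (A : Finset (Site d)) :
    ∃ U : Set (ℝ × ℝ), IsOpen U ∧ (β₀, h₀) ∈ U ∧ ∃ F : ℝ × ℝ → ℝ, AnalyticOnNhd ℝ F U ∧
      ∀ p ∈ U, Tendsto (fun N => torusCorr d A p.1 p.2 N) atTop (nhds (F p)) := by
  obtain ⟨R, hR, D, n, l, w, w', b, b1, hctx⟩ := ctx_exists β₀ h₀ hβ₀ μ hG hW
  obtain ⟨a, ha, hrep⟩ := rep_init (Metric.ball ((β₀ : ℂ), (h₀ : ℂ)) R) D A
  obtain ⟨c, hcd, hcb, hcN⟩ := hrep.iterate hctx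
  let emb : ℝ × ℝ →L[ℝ] ℂ × ℂ := Complex.ofRealCLM.prodMap Complex.ofRealCLM
  have hemb : ∀ p, emb p = ((p.1 : ℂ), (p.2 : ℂ)) := fun p => rfl
  refine ⟨emb ⁻¹' (Metric.ball ((β₀ : ℂ), (h₀ : ℂ)) (R / 2)), Metric.isOpen_ball.preimage emb.continuous,
    ?_, fun p => (∑' k, c k (emb p)).re, ?_, ?_⟩
  · simp only [Set.mem_preimage, hemb]
    exact Metric.mem_ball_self (by positivity)
  · intro p hp
    have h1 := analytic_tsum c _ (R / 2) R a (by positivity) (by linarith) hcd hcb _ hp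
    have h2 : AnalyticAt ℝ (fun p => ∑' k, c k p) (emb p) := h1.restrictScalars
    have h3 : AnalyticAt ℝ (fun p => ∑' k, c k (emb p)) p := h2.comp' (emb.analyticAt p)
    exact (Complex.reCLM.analyticAt _).comp' h3
  · intro p hp
    have hpR : emb p ∈ Metric.ball ((β₀ : ℂ), (h₀ : ℂ)) R :=
      Metric.ball_subset_ball (by linarith) hp
    have hgeo : Summable (fun k : ℕ => a * (1/4 : ℝ) ^ k) :=
      (summable_geometric_of_lt_one (by norm_num) (by norm_num)).mul_left a
    have hsum : Summable (fun k => c k (emb p)) :=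
      Summable.of_norm_bounded hgeo (fun k => hcb k _ hpR)
    have hpart := hsum.hasSum.tendsto_sum_nat
    have hC : Tendsto (fun N => (torusCorr d A p.1 p.2 N : ℂ)) atTop (nhds (∑' k, c k (emb p))) := by
      rw [Metric.tendsto_nhds]
      intro ε hε
      have h0 : Tendsto (fun k : ℕ => a * (1/4 : ℝ) ^ k) atTop (nhds 0) := hgeo.tendsto_atTop_zero
      obtain ⟨k, hk1, hk2⟩ := ((h0.eventually_lt_const (half_pos hε)).and
        ((Metric.tendsto_nhds.1 hpart) (ε / 2) (half_pos hε))).exists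
      filter_upwards [hcN k] with N hN
      have h5 := hN p.1 p.2 hpR
      rw [nuN_corr]
      refine (dist_triangle _ (∑ j ∈ Finset.range k, c j (emb p)) _).trans_lt ?_
      rw [dist_eq_norm]
      have h6 : ‖nuN d N p.1 p.2 (fun ω => ∏ i ∈ A, (spin (ω i) : ℂ)) - ∑ j ∈ Finset.range k, c j (emb p)‖
        ≤ a * (1 / 4) ^ k := h5
      linarith
    have := (Complex.continuous_re.tendsto _).comp hC
    simpa [Function.comp_def] using this

end IsingP


/-- if some Gibbs measure at `(β₀,h₀)` is weak mixing, then for every finite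
`A ⊂ ℤ^d` the torus correlation `⟨σ_A⟩_{N,β,h}` converges, as `N → ∞`, to a function of
`(β,h)` that is real-analytic near `(β₀,h₀)`. -/
theorem correlation_analytic_of_weakMixing (d : ℕ) (hd : 1 ≤ d) (β₀ h₀ : ℝ) (hβ₀ : 0 ≤ β₀)
    (μ : MeasureTheory.Measure (IsingP.Config d))
    (hGibbs : IsingP.IsGibbs d β₀ h₀ μ) (hWM : IsingP.WeakMixing d μ)
    (A : Finset (IsingP.Site d)) :
    ∃ U : Set (ℝ × ℝ), IsOpen U ∧ (β₀, h₀) ∈ U ∧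
      ∃ F : ℝ × ℝ → ℝ, AnalyticOnNhd ℝ F U ∧
        ∀ p ∈ U, Filter.Tendsto (fun N : ℕ => IsingP.torusCorr d A p.1 p.2 N)
          Filter.atTop (nhds (F p)) := by
  exact IsingP.main_aux β₀ h₀ hβ₀ μ hGibbs hWM A
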